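/- arXiv:1907.05803 — 2 statements merged into one kernel-verified Lean document; each statement's English description precedes it below -/
import Mathlib

section
/- Let d ≥ 2 and consider the Coulomb kernel g on ℝ^d and the confining potential V(x) = |x|². Then the electrostatic energy functional E(μ) = ∬ (g(x−y) + (V(x)+V(y))/2) μ(dx)μ(dy) has a unique minimizer over the probability measures on ℝ^d, and this minimizer is the uniform probability measure on the closed unit ball of ℝ^d. -/
open MeasureTheory Filter Metric
open scoped ENNReal NNReal RealInnerProductSpace BigOperators Topology ProbabilityTheory Classical

noncomputable section

/-- `ℝ^d` as a Euclidean space. -/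
abbrev Euc (d : ℕ) : Type := EuclideanSpace ℝ (Fin d)

/-- The Coulomb kernel `g`, valued in `ℝ ∪ {+∞}` (`= ⊤` at the origin). -/
noncomputable def coulombK (d : ℕ) (x : Euc d) : EReal :=
  if x = 0 then ⊤
  else if d = 2 then ((Real.log (1 / ‖x‖) : ℝ) : EReal)
  else ((1 / (((d : ℝ) - 2) * ‖x‖ ^ ((d : ℕ) - 2)) : ℝ) : EReal)

/-- Positive part of an extended real, as an extended nonnegative real. -/
noncomputable def posP (x : EReal) : ℝ≥0∞ := if x = ⊤ then ⊤ else ENNReal.ofReal x.toReal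

/-- The electrostatic energy `E(μ) = ∬ (g(x-y) + (V x + V y)/2) dμ dμ`, valued in `EReal`,
defined as the difference of the integrals of the positive and negative parts of the
integrand. -/
noncomputable def energy (d : ℕ) (V : Euc d → ℝ) (μ : Measure (Euc d)) : EReal :=
  ((∫⁻ q : Euc d × Euc d,
      posP (coulombK d (q.1 - q.2) + (((V q.1 + V q.2) / 2 : ℝ) : EReal)) ∂(μ.prod μ) : ℝ≥0∞) : EReal)
  - ((∫⁻ q : Euc d × Euc d,
      posP (-(coulombK d (q.1 - q.2) + (((V q.1 + V q.2) / 2 : ℝ) : EReal))) ∂(μ.prod μ) : ℝ≥0∞) : EReal)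

/-- Finiteness of the `p`-th moment of a measure on `ℝ^d`. -/
def FiniteMoment (d : ℕ) (p : ℝ) (μ : Measure (Euc d)) : Prop :=
  ∫⁻ x, ENNReal.ofReal (‖x‖ ^ p) ∂μ ≠ ⊤

/-- Couplings of two measures. -/
def Couplings (d : ℕ) (μ ν : Measure (Euc d)) : Set (Measure (Euc d × Euc d)) :=
  {π | π.map Prod.fst = μ ∧ π.map Prod.snd = ν}

/-- The `p`-Wasserstein distance (valued in `ℝ≥0∞`). -/
noncomputable def wassDist (d : ℕ) (p : ℝ) (μ ν : Measure (Euc d)) : ℝ≥0∞ :=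
  (⨅ π ∈ Couplings d μ ν, ∫⁻ q : Euc d × Euc d, ENNReal.ofReal (‖q.1 - q.2‖ ^ p) ∂π) ^ (1 / p)

/-- Real-valued Coulomb kernel (junk value at the origin; only used in densities with
respect to Lebesgue measure, for which the diagonal is negligible). -/
noncomputable def coulombKR (d : ℕ) (x : Euc d) : ℝ :=
  if d = 2 then Real.log (1 / ‖x‖) else 1 / (((d : ℝ) - 2) * ‖x‖ ^ ((d : ℕ) - 2))

/-- The Coulomb gas Hamiltonian `H_n`. -/
noncomputable def hamiltonian (d n : ℕ) (V : Euc d → ℝ) (x : Fin n → Euc d) : ℝ :=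
  (1 / (n : ℝ)) * ∑ i, V (x i)
    + (1 / (n : ℝ) ^ 2) *
        ∑ q ∈ Finset.univ.filter (fun q : Fin n × Fin n => q.1 ≠ q.2), coulombKR d (x q.1 - x q.2)

/-- The Gibbs measure `P_n` with density proportional to `exp(-β H_n)`. -/
noncomputable def gibbs (d n : ℕ) (β : ℝ) (V : Euc d → ℝ) : Measure (Fin n → Euc d) :=
  ((∫⁻ x, ENNReal.ofReal (Real.exp (-β * hamiltonian d n V x)) ∂(Measure.pi fun _ => volume))⁻¹) •
    (Measure.pi fun _ => (volume : Measure (Euc d))).withDensity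
      (fun x => ENNReal.ofReal (Real.exp (-β * hamiltonian d n V x)))

/-- Empirical measure of a configuration. -/
noncomputable def empMeas (d n : ℕ) (x : Fin n → Euc d) : Measure (Euc d) :=
  ((n : ℝ≥0∞))⁻¹ • ∑ i, Measure.dirac (x i)

/-- Uniform probability measure on the closed ball of radius 1 centered at `c`. -/
noncomputable def uniformBall (d : ℕ) (c : Euc d) : Measure (Euc d) :=
  (volume (Metric.closedBall c 1))⁻¹ • volume.restrict (Metric.closedBall c 1)

/-- Support of a measure. -/
def measSupport (d : ℕ) (μ : Measure (Euc d)) : Set (Euc d) :=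
  {x | ∀ U : Set (Euc d), IsOpen U → x ∈ U → μ U ≠ 0}

/-- The Coulomb interaction energy `J(μ) = ∬ g(x-y) dμ dμ` (the energy with `V = 0`). -/
noncomputable def interactionJ (d : ℕ) (μ : Measure (Euc d)) : EReal :=
  energy d (fun _ => 0) μ

/-- A set has null capacity if it contains no compact set carrying a probability measure
of finite Coulomb interaction energy. -/
def NullCapacity (d : ℕ) (A : Set (Euc d)) : Prop :=
  ∀ K : Set (Euc d), K ⊆ A → IsCompact K →
    ∀ μ : Measure (Euc d), IsProbabilityMeasure μ → μ Kᶜ = 0 → interactionJ d μ = ⊤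

/-- A property holds quasi-everywhere if it holds outside a Borel set of null capacity. -/
def QuasiEverywhere (d : ℕ) (P : Euc d → Prop) : Prop :=
  ∃ N : Set (Euc d), MeasurableSet N ∧ NullCapacity d N ∧ ∀ x ∉ N, P x

/-- The Coulomb potential `(g * μ)(x) = ∫ g(x - y) μ(dy)`, valued in `EReal`. -/
noncomputable def coulombPot (d : ℕ) (μ : Measure (Euc d)) (x : Euc d) : EReal :=
  ((∫⁻ y, posP (coulombK d (x - y)) ∂μ : ℝ≥0∞) : EReal)
  - ((∫⁻ y, posP (-(coulombK d (x - y))) ∂μ : ℝ≥0∞) : EReal)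

/-- The set `P_p(ℝ^d)` of probability measures with finite `p`-th moment. -/
def Ppd (d : ℕ) (p : ℝ) : Set (Measure (Euc d)) :=
  {μ | IsProbabilityMeasure μ ∧ FiniteMoment d p μ}

/-- `B` is closed in the `p`-Wasserstein topology (within `P_p(ℝ^d)`). -/
def WClosedIn (d : ℕ) (p : ℝ) (B : Set (Measure (Euc d))) : Prop :=
  ∀ μ ∈ Ppd d p, (∀ ε : ℝ, 0 < ε → ∃ ν ∈ B, wassDist d p μ ν < ENNReal.ofReal ε) → μ ∈ B

/-- Interior of `B` in the `p`-Wasserstein topology (within `P_p(ℝ^d)`). -/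
def wInterior (d : ℕ) (p : ℝ) (B : Set (Measure (Euc d))) : Set (Measure (Euc d)) :=
  {μ | μ ∈ B ∧ ∃ ε : ℝ, 0 < ε ∧ ∀ ν ∈ Ppd d p, wassDist d p μ ν < ENNReal.ofReal ε → ν ∈ B}

/-- The growth condition `V(x) ≥ a |x|^q - R`. -/
def GrowthCond (d : ℕ) (V : Euc d → ℝ) (a q R : ℝ) : Prop :=
  ∀ x : Euc d, a * ‖x‖ ^ q - R ≤ V x



lemma euc_nontrivial (d : ℕ) (hd : 2 ≤ d) : Nontrivial (Euc d) := by
  have : Nonempty (Fin d) := ⟨⟨0, by omega⟩⟩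
  infer_instance

lemma polar_aux (d : ℕ) (hd : 2 ≤ d) (f : Euc d → ℝ) (hf : Integrable f) :
    ∫ x, f x = ∫ ω : sphere (0 : Euc d) 1, (∫ r in Set.Ioi (0:ℝ), r ^ (d-1) * f (r • (ω : Euc d)))
        ∂(volume : Measure (Euc d)).toSphere ∧
    Integrable (fun ω : sphere (0 : Euc d) 1 => ∫ r in Set.Ioi (0:ℝ), r ^ (d-1) * f (r • (ω : Euc d)))
        (volume : Measure (Euc d)).toSphere := by
  have := euc_nontrivial d hd
  set μ : Measure (Euc d) := volume with hμ
  have hdim : Module.finrank ℝ (Euc d) = d := by simp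
  have hmp := μ.measurePreserving_homeomorphUnitSphereProd
  rw [hdim] at hmp
  set F : sphere (0 : Euc d) 1 × Set.Ioi (0:ℝ) → ℝ := fun p => f ((p.2 : ℝ) • (p.1 : Euc d)) with hF
  have hFc : ∀ x : ({(0:Euc d)}ᶜ : Set (Euc d)), F (homeomorphUnitSphereProd (Euc d) x) = f x := by
    intro x
    have h := homeomorphUnitSphereProd_symm_apply_coe (Euc d) (homeomorphUnitSphereProd (Euc d) x)
    rw [Homeomorph.symm_apply_apply] at h
    simp only [hF]
    rw [← h]
  have hFi : Integrable F (μ.toSphere.prod (.volumeIoiPow (d - 1))) := by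
    rw [← hmp.integrable_comp_emb (Homeomorph.measurableEmbedding _)]
    have : F ∘ (homeomorphUnitSphereProd (Euc d)) = f ∘ Subtype.val := by
      funext x; exact hFc x
    rw [this, ← (MeasurableEmbedding.subtype_coe (measurableSet_singleton (0:Euc d)).compl).integrable_map_iff,
      map_comap_subtype_coe (measurableSet_singleton (0:Euc d)).compl]
    exact hf.restrict
  have hin : ∀ ω : sphere (0 : Euc d) 1, ∫ r, F (ω, r) ∂(.volumeIoiPow (d - 1)) =
      ∫ r in Set.Ioi (0:ℝ), r ^ (d-1) * f (r • (ω : Euc d)) := by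
    intro ω
    simp only [Measure.volumeIoiPow, ENNReal.ofReal]
    rw [integral_withDensity_eq_integral_smul]
    · simp only [hF]
      rw [integral_subtype_comap measurableSet_Ioi
        fun a : ℝ ↦ Real.toNNReal (a ^ (d - 1)) • f (a • (ω : Euc d)),
        setIntegral_congr_fun measurableSet_Ioi fun x hx ↦ ?_]
      rw [NNReal.smul_def, Real.coe_toNNReal _ (pow_nonneg hx.out.le _), smul_eq_mul]
    · exact (measurable_subtype_coe.pow_const _).real_toNNReal
  constructor
  · calc ∫ x, f x ∂μ = ∫ x : ({(0)}ᶜ : Set (Euc d)), f x.1 ∂(μ.comap (↑)) := by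
          rw [integral_subtype_comap (measurableSet_singleton _).compl fun x ↦ f x,
            restrict_compl_singleton]
      _ = ∫ x, F x ∂(μ.toSphere.prod (.volumeIoiPow (d - 1))) := by
          rw [← hmp.integral_comp (Homeomorph.measurableEmbedding _)]
          simp only [hFc]
      _ = _ := by
          rw [integral_prod _ hFi]
          simp only [hin]
  · have := hFi.integral_prod_left
    simpa only [hin] using this

/-- chord length -/
def chordM (a q : ℝ) : ℝ := volume.real {r : ℝ | 0 < r ∧ r^2 - 2*r*a + q ≤ 1}

lemma chord_meas (a q : ℝ) : MeasurableSet {r : ℝ | 0 < r ∧ r^2 - 2*r*a + q ≤ 1} := by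
  apply MeasurableSet.inter
  · exact measurableSet_Ioi
  · exact measurableSet_le (f := fun r : ℝ => r^2 - 2*r*a + q) (g := fun _ => (1:ℝ)) (by fun_prop) (by fun_prop)

lemma chord_fin (a q : ℝ) (hq : 0 ≤ q) : volume {r : ℝ | 0 < r ∧ r^2 - 2*r*a + q ≤ 1} ≠ ∞ := by
  refine ((measure_mono (t := Set.Icc 0 (2*|a|+1)) ?_).trans_lt measure_Icc_lt_top).ne
  · rintro r ⟨h1, h2⟩
    refine ⟨h1.le, ?_⟩
    by_contra h
    push Not at h
    have := le_abs_self a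
    have := abs_nonneg a
    nlinarith

lemma chord_eq (a q : ℝ) (hq : q ≤ 1) : chordM a q = a + √(a^2+1-q) := by
  have hD : 0 ≤ a^2+1-q := by nlinarith [sq_nonneg a]
  have hs := Real.sq_sqrt hD
  have hs0 := Real.sqrt_nonneg (a^2+1-q)
  set s := √(a^2+1-q)
  have hsa : |a| ≤ s := by
    apply abs_le_of_sq_le_sq _ hs0
    linarith
  have h1 := abs_le.1 hsa
  have : {r : ℝ | 0 < r ∧ r^2 - 2*r*a + q ≤ 1} = Set.Ioc 0 (a+s) := by
    ext r
    simp only [Set.mem_ofPred_eq, Set.mem_Ioc]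
    constructor
    · rintro ⟨h0, h⟩
      refine ⟨h0, ?_⟩
      by_contra hc
      push Not at hc
      nlinarith
    · rintro ⟨h0, h⟩
      refine ⟨h0, ?_⟩
      have : (r-a)^2 ≤ s^2 := by
        apply sq_le_sq'
        · linarith
        · linarith
      nlinarith
  rw [chordM, this, Real.volume_real_Ioc_of_le] <;> linarith

lemma chord_diff_eq (a q : ℝ) (hq : q ≤ 1) : chordM a q - chordM (-a) q = 2*a := by
  rw [chord_eq _ _ hq, chord_eq _ _ hq]; ring_nf

lemma chord_diff_le (a q : ℝ) (ha : 0 ≤ a) : chordM a q - chordM (-a) q ≤ 2*a := by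
  rcases le_total q 1 with h | h
  · exact (chord_diff_eq a q h).le
  · have h1 : chordM a q ≤ 2*a := by
      have : {r : ℝ | 0 < r ∧ r^2 - 2*r*a + q ≤ 1} ⊆ Set.Ioc 0 (2*a) := by
        rintro r ⟨h0, h2⟩
        refine ⟨h0, ?_⟩
        by_contra hc
        push Not at hc
        nlinarith
      have h2 := measureReal_mono (μ := volume) this measure_Ioc_lt_top.ne
      rw [Real.volume_real_Ioc_of_le (by linarith)] at h2
      rw [chordM]; linarith
    have h2 : 0 ≤ chordM (-a) q := measureReal_nonneg
    linarith

lemma chord_key (b t q : ℝ) (ht : 0 ≤ t) :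
    b * (chordM (t*b) q - chordM (-(t*b)) q) ≤ 2*t*b^2 ∧
    (q ≤ 1 → b * (chordM (t*b) q - chordM (-(t*b)) q) = 2*t*b^2) := by
  refine ⟨?_, fun h => by rw [chord_diff_eq _ _ h]; ring⟩
  rcases le_total 0 b with hb | hb
  · have := mul_le_mul_of_nonneg_left (chord_diff_le (t*b) q (by positivity)) hb
    linarith
  · have h1 := chord_diff_le (-(t*b)) q (by nlinarith)
    rw [neg_neg] at h1
    nlinarith

lemma chord_int (d : ℕ) (z ω : Euc d) (hω : ‖ω‖ = 1) :
    IntegrableOn (fun r : ℝ => (closedBall (0:Euc d) 1).indicator (1 : Euc d → ℝ) (z - r • ω)) (Set.Ioi 0) ∧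
    ∫ r in Set.Ioi (0:ℝ), (closedBall (0:Euc d) 1).indicator (1 : Euc d → ℝ) (z - r • ω)
      = chordM ⟪z, ω⟫ (‖z‖^2) := by
  have key : ∀ r : ℝ, ‖z - r • ω‖ ≤ 1 ↔ r^2 - 2*r*⟪z, ω⟫ + ‖z‖^2 ≤ 1 := by
    intro r
    rw [← sq_le_one_iff₀ (norm_nonneg _), norm_sub_sq_real, norm_smul, inner_smul_right, hω]
    simp only [Real.norm_eq_abs, mul_one, sq_abs]
    constructor <;> intro h <;> linarith
  have hfun : Set.EqOn (fun r : ℝ => (closedBall (0:Euc d) 1).indicator (1 : Euc d → ℝ) (z - r • ω))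
      ({r : ℝ | 0 < r ∧ r^2 - 2*r*⟪z, ω⟫ + ‖z‖^2 ≤ 1}.indicator (fun _ => (1:ℝ))) (Set.Ioi 0) := by
    intro r hr
    simp only [Set.indicator, mem_closedBall, dist_zero_right, key, Set.mem_ofPred_eq]
    have : 0 < r := hr
    simp [this]
  have hi : Integrable ({r : ℝ | 0 < r ∧ r^2 - 2*r*⟪z, ω⟫ + ‖z‖^2 ≤ 1}.indicator (fun _ => (1:ℝ))) := by
    rw [integrable_indicator_iff (chord_meas _ _)]
    exact integrableOn_const (chord_fin _ _ (by positivity))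
  constructor
  · rw [integrableOn_congr_fun hfun measurableSet_Ioi]
    exact hi.integrableOn
  · rw [setIntegral_congr_fun measurableSet_Ioi hfun, setIntegral_indicator (chord_meas _ _)]
    rw [setIntegral_const, chordM, smul_eq_mul, mul_one]
    congr 1
    ext r; simp

/-- local integrability of `‖u‖^{1-d}` -/
lemma loc_int (d : ℕ) (hd : 2 ≤ d) (R : ℝ) : 
    IntegrableOn (fun u : Euc d => (‖u‖^(d-1))⁻¹) (ball 0 R) := by
  have := euc_nontrivial d hd
  rw [integrableOn_fun_norm_addHaar (μ := (volume : Measure (Euc d))) (f := fun r => (r^(d-1))⁻¹)]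
  have hdim : Module.finrank ℝ (Euc d) = d := by simp
  rw [hdim]
  have : Set.EqOn (fun y : ℝ => y^(d-1) • (y^(d-1))⁻¹) (fun _ => 1) (Set.Ioo 0 R) := by
    intro y hy
    have : y ≠ 0 := hy.1.ne'
    simp only [smul_eq_mul]
    field_simp
  rw [integrableOn_congr_fun this measurableSet_Ioo]
  exact integrableOn_const (by simp)

/-- second moment on sphere -/
lemma sphere_sq (d : ℕ) (hd : 2 ≤ d) (x : Euc d) :
    ∫ ω : sphere (0 : Euc d) 1, ⟪x, (ω : Euc d)⟫^2 ∂(volume : Measure (Euc d)).toSphere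
      = volume.real (ball (0:Euc d) 1) * ‖x‖^2 := by
  have := euc_nontrivial d hd
  have hdim : Module.finrank ℝ (Euc d) = d := by simp
  -- generic polar for 1_{ball} h, h 2-homogeneous
  have hint : ∀ h : Euc d → ℝ, Continuous h →
      Integrable (fun u => (closedBall (0:Euc d) 1).indicator h u) := by
    intro h hc
    rw [integrable_indicator_iff measurableSet_closedBall]
    exact hc.continuousOn.integrableOn_compact (isCompact_closedBall _ _)
  have hpol : ∀ h : Euc d → ℝ, Continuous h → (∀ (r : ℝ) u, h (r • u) = r^2 * h u) →
      ∫ u, (closedBall (0:Euc d) 1).indicator h u = 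
      (∫ ω : sphere (0 : Euc d) 1, h ω ∂(volume : Measure (Euc d)).toSphere) * ∫ r in Set.Ioc (0:ℝ) 1, r^(d+1) := by
    intro h hc hh
    rw [(polar_aux d hd _ (hint h hc)).1, ← integral_mul_const]
    congr 1
    funext ω
    rw [← integral_const_mul]
    have hω : ‖(ω : Euc d)‖ = 1 := by simp
    have : Set.EqOn (fun r : ℝ => r^(d-1) * (closedBall (0:Euc d) 1).indicator h (r • (ω : Euc d)))
       ((Set.Iic 1).indicator (fun r => h ω * r^(d+1))) (Set.Ioi 0) := by
      intro r hr
      have hr : 0 < r := hr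
      simp only [Set.indicator, mem_closedBall, dist_zero_right, norm_smul, hω, mul_one, Set.mem_Iic,
        Real.norm_eq_abs, abs_of_pos hr]
      split_ifs
      · rw [hh]
        obtain ⟨k, rfl⟩ : ∃ k, d = k + 1 := ⟨d-1, by omega⟩
        simp only [Nat.add_sub_cancel]
        ring
      · simp
    rw [setIntegral_congr_fun measurableSet_Ioi this, setIntegral_indicator measurableSet_Iic]
    rfl
  set m := ∫ r in Set.Ioc (0:ℝ) 1, r^(d+1) with hm
  have hm0 : m ≠ 0 := by
    rw [hm, ← intervalIntegral.integral_of_le zero_le_one, integral_pow]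
    simp; positivity
  set P : Euc d → ℝ := fun x => ∫ u, (closedBall (0:Euc d) 1).indicator (fun u => ⟪x, u⟫^2) u with hP
  have hPx : ∀ x, P x = (∫ ω : sphere (0 : Euc d) 1, ⟪x, (ω : Euc d)⟫^2 ∂(volume : Measure (Euc d)).toSphere) * m := by
    intro x
    exact hpol (fun u => ⟪x, u⟫^2) (by fun_prop) (by intro r u; rw [inner_smul_right]; ring)
  -- rotation invariance
  have hrot : ∀ x y : Euc d, ‖x‖ = ‖y‖ → P x = P y := by
    intro x y hxy
    set T := (ℝ ∙ (x - y))ᗮ.reflection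
    have hT : T x = y := Submodule.reflection_sub hxy
    have := (T.measurePreserving).integral_comp' (f := T.toMeasurableEquiv) 
      (fun u => (closedBall (0:Euc d) 1).indicator (fun u => ⟪y, u⟫^2) u)
    simp only [hP]
    rw [← this]
    congr 1
    funext u
    simp only [Set.indicator, mem_closedBall, dist_zero_right, LinearIsometryEquiv.coe_toMeasurableEquiv,
      LinearIsometryEquiv.norm_map]
    rw [← hT, LinearIsometryEquiv.inner_map_map]
  have hscale : ∀ (c : ℝ) x, P (c • x) = c^2 * P x := by
    intro c x
    simp only [hP]
    rw [← integral_const_mul]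
    congr 1
    funext u
    simp only [Set.indicator, inner_smul_left]
    split_ifs
    · simp; ring
    · simp
  set e : Fin d → Euc d := fun i => EuclideanSpace.single i 1
  have he : ∀ i, ‖e i‖ = 1 := by intro i; simp [e]
  have hPe : ∀ i, P x = ‖x‖^2 * P (e i) := by
    intro i
    rw [← hscale]
    apply hrot
    rw [norm_smul, he]; simp
  have hsum : ∑ i, P (e i) = ((d:ℝ) * volume.real (ball (0:Euc d) 1)) * m := by
    have hS := hpol (fun u => ‖u‖^2) (by fun_prop) (by intro r u; rw [norm_smul, mul_pow]; simp)
    have h1 : ∫ ω : sphere (0 : Euc d) 1, ‖(ω : Euc d)‖^2 ∂(volume : Measure (Euc d)).toSphere = 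
       (d:ℝ) * volume.real (ball (0:Euc d) 1) := by
      have : ∀ ω : sphere (0 : Euc d) 1, ‖(ω : Euc d)‖^2 = 1 := by
        intro ω
        have hω : ‖(ω : Euc d)‖ = 1 := by simp
        rw [hω]; norm_num
      simp only [this]
      rw [integral_const, Measure.toSphere_real_apply_univ, hdim]; simp
    rw [h1] at hS
    rw [← hS]
    simp only [hP]
    rw [← integral_finsetSum]
    · congr 1
      funext u
      simp only [Set.indicator]
      split_ifs
      · rw [EuclideanSpace.norm_sq_eq]
        simp [e, EuclideanSpace.inner_single_left]
      · simp
    · intro i _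
      exact hint _ (by fun_prop)
  have hd0 : (d:ℝ) ≠ 0 := by positivity
  have h3 : (d:ℝ) * P x = ‖x‖^2 * (((d:ℝ) * volume.real (ball (0:Euc d) 1)) * m) := by
    rw [← hsum, Finset.mul_sum]
    rw [← Finset.sum_congr rfl (fun i _ => hPe i)]
    simp
  rw [hPx] at h3
  have : (d:ℝ) * m ≠ 0 := mul_ne_zero hd0 hm0
  apply mul_left_cancel₀ this
  linarith


/-- directional derivative kernel -/
def kern (d : ℕ) (x v : Euc d) : ℝ := ⟪x, v⟫ / ‖v‖^d

lemma kern_meas (d : ℕ) (x : Euc d) : Measurable (kern d x) := by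
  unfold kern; fun_prop

lemma kern_bound (d : ℕ) (hd : 2 ≤ d) (x v : Euc d) : ‖kern d x v‖ ≤ ‖x‖ * (‖v‖^(d-1))⁻¹ := by
  unfold kern
  obtain ⟨k, rfl⟩ : ∃ k, d = k + 1 := ⟨d-1, by omega⟩
  simp only [Nat.add_sub_cancel]
  rcases eq_or_ne v 0 with rfl | hv
  · simp; positivity
  · have hv : 0 < ‖v‖ := norm_pos_iff.2 hv
    rw [norm_div, norm_pow, norm_norm, div_le_iff₀ (by positivity)]
    calc _ ≤ ‖x‖ * ‖v‖ := norm_inner_le_norm _ _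
      _ = _ := by field_simp; ring

lemma unif_bound (d : ℕ) (hd : 2 ≤ d) : ∃ C : ℝ, 0 ≤ C ∧ ∀ z : Euc d,
    IntegrableOn (fun y => (‖z - y‖^(d-1))⁻¹) (closedBall (0 : Euc d) 1) ∧
    ∫ y in closedBall (0 : Euc d) 1, (‖z - y‖^(d-1))⁻¹ ≤ C := by
  set φ : Euc d → ℝ := (ball (0:Euc d) 1).indicator (fun u => (‖u‖^(d-1))⁻¹) with hφ
  have hφi : Integrable φ := (integrable_indicator_iff measurableSet_ball).2 (loc_int d hd 1)
  have hφ0 : ∀ u, 0 ≤ φ u := by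
    intro u; rw [hφ]; apply Set.indicator_nonneg; intro u _; positivity
  have hle : ∀ u : Euc d, (‖u‖^(d-1))⁻¹ ≤ φ u + 1 := by
    intro u
    by_cases h : u ∈ ball (0:Euc d) 1
    · simp [hφ, h]
    · have h2 : 1 ≤ ‖u‖ := by simpa using h
      have := hφ0 u
      have : (‖u‖^(d-1))⁻¹ ≤ 1 := inv_le_one_of_one_le₀ (one_le_pow₀ h2)
      linarith
  have hfin : IntegrableOn (fun _ : Euc d => (1:ℝ)) (closedBall (0 : Euc d) 1) :=
    integrableOn_const (isCompact_closedBall _ _).measure_lt_top.ne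
  refine ⟨(∫ u, φ u) + volume.real (closedBall (0:Euc d) 1), by
    have := integral_nonneg (μ := volume) (f := φ) (fun u => hφ0 u); positivity, fun z => ?_⟩
  have hz : Integrable (fun y => φ (z - y)) := hφi.comp_sub_left z
  have h1 : IntegrableOn (fun y => φ (z - y) + 1) (closedBall (0 : Euc d) 1) := 
    hz.integrableOn.add hfin
  have h2 : IntegrableOn (fun y => (‖z - y‖^(d-1))⁻¹) (closedBall (0 : Euc d) 1) := by
    refine h1.mono' (by fun_prop) (ae_of_all _ fun y => ?_)
    rw [Real.norm_of_nonneg (by positivity)]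
    exact hle _
  refine ⟨h2, ?_⟩
  calc _ ≤ ∫ y in closedBall (0 : Euc d) 1, (φ (z - y) + 1) := 
        integral_mono h2 h1 (fun y => hle _)
    _ = (∫ y in closedBall (0 : Euc d) 1, φ (z - y)) + volume.real (closedBall (0:Euc d) 1) := by
        rw [integral_add hz.integrableOn hfin]; simp
    _ ≤ _ := by
        gcongr
        calc _ ≤ ∫ y, φ (z - y) := setIntegral_le_integral hz (ae_of_all _ fun y => hφ0 _)
          _ = _ := integral_sub_left_eq_self φ volume z

lemma kern_ball (d : ℕ) (hd : 2 ≤ d) (x : Euc d) (t : ℝ) (ht : 0 ≤ t) :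
    ∫ y in closedBall (0:Euc d) 1, kern d x (t • x - y) ≤ t * (volume.real (ball (0:Euc d) 1) * ‖x‖^2) ∧
    (‖t • x‖ ≤ 1 → ∫ y in closedBall (0:Euc d) 1, kern d x (t • x - y) 
      = t * (volume.real (ball (0:Euc d) 1) * ‖x‖^2)) := by
  set z := t • x with hz
  set χ : Euc d → ℝ := (closedBall (0:Euc d) 1).indicator (1 : Euc d → ℝ) with hχ
  have hχm : Measurable χ := measurable_const.indicator measurableSet_closedBall
  obtain ⟨C, -, hC⟩ := unif_bound d hd
  set f : Euc d → ℝ := fun v => χ (z - v) * kern d x v with hf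
  have hkI : IntegrableOn (fun y => kern d x (z - y)) (closedBall (0:Euc d) 1) := by
    refine ((hC z).1.const_mul ‖x‖).mono' ?_ (ae_of_all _ fun y => kern_bound d hd x _)
    exact ((kern_meas d x).comp (by fun_prop)).aestronglyMeasurable
  have hind : (fun y => f (z - y)) = (closedBall (0:Euc d) 1).indicator (fun y => kern d x (z - y)) := by
    funext y
    simp only [hf, hχ, sub_sub_cancel, Set.indicator]
    split_ifs <;> simp
  have hfz : Integrable (fun y => f (z - y)) := by
    rw [hind, integrable_indicator_iff measurableSet_closedBall]; exact hkI
  have hfi : Integrable f := by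
    have := hfz.comp_sub_left z
    simpa using this
  have e1 : ∫ y in closedBall (0:Euc d) 1, kern d x (z - y) = ∫ v, f v := by
    rw [← integral_indicator measurableSet_closedBall, ← hind, integral_sub_left_eq_self f volume z]
  have e2 : ∫ v, f v = ∫ v, f (-v) := (integral_neg_eq_self f volume).symm
  have hfn : Integrable (fun v => f (-v)) := hfi.comp_neg
  have e3 : 2 * ∫ v, f v = ∫ v, (f v + f (-v)) := by
    rw [integral_add hfi hfn, ← e2]; ring
  obtain ⟨p1, p2⟩ := polar_aux d hd _ (hfi.add hfn)
  have hin : ∀ ω : sphere (0 : Euc d) 1, 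
      ∫ r in Set.Ioi (0:ℝ), r ^ (d-1) * ((f + fun v => f (-v)) (r • (ω : Euc d))) = 
      ⟪x, (ω:Euc d)⟫ * (chordM (t * ⟪x, (ω:Euc d)⟫) (‖z‖^2) - chordM (-(t * ⟪x, (ω:Euc d)⟫)) (‖z‖^2)) := by
    intro ω
    have hω : ‖(ω : Euc d)‖ = 1 := by simp
    have hω' : ‖-(ω : Euc d)‖ = 1 := by simp
    obtain ⟨i1, j1⟩ := chord_int d z ω hω
    obtain ⟨i2, j2⟩ := chord_int d z (-ω) hω'
    have h1 : ⟪z, (ω : Euc d)⟫ = t * ⟪x, (ω:Euc d)⟫ := by rw [hz, inner_smul_left]; simp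
    rw [inner_neg_right, h1] at j2
    rw [h1] at j1
    rw [← j1, ← j2, ← integral_sub i1 i2, ← integral_const_mul]
    apply setIntegral_congr_fun measurableSet_Ioi
    intro r hr
    have hr : 0 < r := hr
    have hk : kern d x (r • (ω:Euc d)) = ⟪x, (ω:Euc d)⟫ * (r^(d-1))⁻¹ := by
      unfold kern
      rw [norm_smul, hω, inner_smul_right, Real.norm_of_nonneg hr.le]
      obtain ⟨k, rfl⟩ : ∃ k, d = k + 1 := ⟨d-1, by omega⟩
      simp only [Nat.add_sub_cancel]
      field_simp
      ring
    have hk' : kern d x (-(r • (ω:Euc d))) = -(⟪x, (ω:Euc d)⟫ * (r^(d-1))⁻¹) := by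
      rw [← hk]; unfold kern; rw [inner_neg_right, norm_neg]; ring
    simp only [Pi.add_apply, hf, hk, hk', smul_neg]
    field_simp
    ring
  simp only [hin] at p1 p2
  have p1' : 2 * ∫ v, f v = _ := e3.trans p1
  have hQ : Integrable (fun ω : sphere (0 : Euc d) 1 => 2 * t * ⟪x, (ω:Euc d)⟫^2) (volume : Measure (Euc d)).toSphere := by
    apply Continuous.integrable_of_hasCompactSupport
    · fun_prop
    · exact HasCompactSupport.of_compactSpace _
  have hQv : ∫ ω : sphere (0 : Euc d) 1, 2 * t * ⟪x, (ω:Euc d)⟫^2 ∂(volume : Measure (Euc d)).toSphere 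
      = 2 * (t * (volume.real (ball (0:Euc d) 1) * ‖x‖^2)) := by
    rw [integral_const_mul, sphere_sq d hd]; ring
  rw [e1]
  constructor
  · have := integral_mono p2 hQ (fun ω => (chord_key ⟪x, (ω:Euc d)⟫ t (‖z‖^2) ht).1)
    rw [hQv] at this
    linarith
  · intro hz1
    have hq : ‖z‖^2 ≤ 1 := by
      rw [sq_le_one_iff₀ (norm_nonneg _)]; exact hz1
    have : ∀ ω : sphere (0 : Euc d) 1, _ := fun ω => (chord_key ⟪x, (ω:Euc d)⟫ t (‖z‖^2) ht).2 hq
    simp only [this] at p1'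
    rw [hQv] at p1'
    linarith

lemma gR_bound (d : ℕ) (hd : 2 ≤ d) (v : Euc d) : ‖coulombKR d v‖ ≤ (1 + ‖v‖^2) * (‖v‖^(d-1))⁻¹ := by
  unfold coulombKR
  rcases eq_or_ne v 0 with rfl | hv
  · have : d - 1 ≠ 0 := by omega
    split_ifs with h
    · simp
    · have : d - 2 ≠ 0 := by omega
      simp [this]
  have hv : 0 < ‖v‖ := norm_pos_iff.2 hv
  split_ifs with h
  · subst h
    simp only [one_div, Real.log_inv, norm_neg, Real.norm_eq_abs]
    have h1 := Real.log_le_sub_one_of_pos hv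
    have h2 := Real.log_le_sub_one_of_pos (inv_pos.2 hv)
    rw [Real.log_inv] at h2
    have h3 : (1 + ‖v‖^2) * (‖v‖^(2-1))⁻¹ = ‖v‖⁻¹ + ‖v‖ := by
      simp; field_simp
    rw [h3, abs_le]
    have := inv_pos.2 hv
    constructor <;> linarith
  · obtain ⟨k, rfl⟩ : ∃ k, d = k + 3 := ⟨d-3, by omega⟩
    have e1 : k + 3 - 2 = k + 1 := by omega
    have e2 : k + 3 - 1 = k + 2 := by omega
    rw [e1, e2]
    push_cast
    have hk : (0:ℝ) < (k:ℝ) + 3 - 2 := by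
      have : (0:ℝ) ≤ k := by positivity
      linarith
    have hk1 : (1:ℝ) ≤ (k:ℝ) + 3 - 2 := by
      have : (0:ℝ) ≤ k := by positivity
      linarith
    rw [Real.norm_of_nonneg (by positivity), ← div_eq_mul_inv, div_le_div_iff₀ (by positivity) (by positivity)]
    have : ‖v‖ ≤ 1 + ‖v‖^2 := by nlinarith
    calc 1 * ‖v‖^(k+2) = ‖v‖ * (1 * ‖v‖^(k+1)) := by ring
      _ ≤ _ := by gcongr

lemma gR_meas (d : ℕ) : Measurable (coulombKR d) := by
  unfold coulombKR
  split_ifs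
  · have := Real.measurable_log; fun_prop
  · fun_prop

lemma gR_deriv (d : ℕ) (hd : 2 ≤ d) (x y : Euc d) (t : ℝ) (hv : t • x - y ≠ 0) :
    HasDerivAt (fun t : ℝ => coulombKR d (t • x - y)) (-kern d x (t • x - y)) t := by
  have h1 : HasDerivAt (fun t : ℝ => t • x - y) x t := by
    simpa using ((hasDerivAt_id t).smul_const x).sub_const y
  have hpos : 0 < ‖t • x - y‖ := norm_pos_iff.2 hv
  have h2 := h1.norm_sq.sqrt (by positivity)
  have h3 : HasDerivAt (fun t : ℝ => ‖t • x - y‖) (⟪x, t • x - y⟫ / ‖t • x - y‖) t := by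
    have e : (fun t : ℝ => √(‖t • x - y‖^2)) = fun t => ‖t • x - y‖ := by
      funext t; rw [Real.sqrt_sq (norm_nonneg _)]
    rw [e] at h2
    convert h2 using 1
    rw [Real.sqrt_sq (norm_nonneg _), real_inner_comm]
    field_simp
  unfold coulombKR kern
  split_ifs with h
  · subst h
    simp only [one_div, Real.log_inv]
    have h4 := (h3.log hpos.ne').neg
    rw [div_div, ← sq] at h4
    exact h4
  · obtain ⟨k, rfl⟩ : ∃ k, d = k + 3 := ⟨d-3, by omega⟩
    have e1 : k + 3 - 2 = k + 1 := by omega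
    rw [e1]
    push_cast
    have hk : (k:ℝ) + 3 - 2 ≠ 0 := by
      have : (0:ℝ) ≤ k := by positivity
      intro h; linarith
    have h4 := ((h3.fun_pow (k+1)).const_mul ((k:ℝ)+3-2)).fun_inv (mul_ne_zero hk (by positivity))
    simp only [one_div]
    refine h4.congr_deriv ?_
    simp only [Nat.add_sub_cancel]
    push_cast
    field_simp
    ring

/-- the potential of the unit ball w.r.t. Lebesgue measure. -/
def potB (d : ℕ) (x : Euc d) : ℝ := ∫ y in closedBall (0:Euc d) 1, coulombKR d (x - y)

lemma potB_int (d : ℕ) (hd : 2 ≤ d) : ∃ C : ℝ, 0 ≤ C ∧ ∀ x : Euc d,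
    IntegrableOn (fun y => coulombKR d (x - y)) (closedBall (0:Euc d) 1) ∧
    ∫ y in closedBall (0:Euc d) 1, ‖coulombKR d (x - y)‖ ≤ C * (1 + ‖x‖^2) := by
  obtain ⟨C, hC0, hC⟩ := unif_bound d hd
  refine ⟨3 * C, by positivity, fun x => ?_⟩
  have hb : ∀ y ∈ closedBall (0:Euc d) 1, ‖coulombKR d (x - y)‖ ≤ (3 * (1 + ‖x‖^2)) * (‖x - y‖^(d-1))⁻¹ := by
    intro y hy
    refine (gR_bound d hd _).trans ?_
    gcongr
    have h1 : ‖x - y‖ ≤ ‖x‖ + 1 := (norm_sub_le _ _).trans (by gcongr; simpa using hy)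
    have := norm_nonneg (x - y)
    have : ‖x - y‖^2 ≤ (‖x‖+1)^2 := by gcongr
    nlinarith [sq_nonneg (‖x‖-1)]
  have hi : IntegrableOn (fun y => coulombKR d (x - y)) (closedBall (0:Euc d) 1) := by
    refine ((hC x).1.const_mul (3 * (1 + ‖x‖^2))).mono' ?_ ?_
    · exact ((gR_meas d).comp (by fun_prop)).aestronglyMeasurable
    · filter_upwards [ae_restrict_mem measurableSet_closedBall] with y hy using hb y hy
  refine ⟨hi, ?_⟩
  calc _ ≤ ∫ y in closedBall (0:Euc d) 1, (3 * (1 + ‖x‖^2)) * (‖x - y‖^(d-1))⁻¹ :=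
        setIntegral_mono_on hi.norm ((hC x).1.const_mul _) measurableSet_closedBall hb
    _ = (3 * (1 + ‖x‖^2)) * ∫ y in closedBall (0:Euc d) 1, (‖x - y‖^(d-1))⁻¹ := integral_const_mul _ _
    _ ≤ (3 * (1 + ‖x‖^2)) * C := by gcongr; exact (hC x).2
    _ = _ := by ring

lemma potB_diff (d : ℕ) (hd : 2 ≤ d) (x : Euc d) : 
    potB d x - potB d 0 = - ∫ t in (0:ℝ)..1, ∫ y in closedBall (0:Euc d) 1, kern d x (t • x - y) := by
  obtain ⟨C, hC0, hC⟩ := unif_bound d hd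
  obtain ⟨C', -, hC'⟩ := potB_int d hd
  set B := closedBall (0:Euc d) 1
  have hmeas : Measurable (Function.uncurry fun (t:ℝ) (y : Euc d) => kern d x (t • x - y)) := by
    refine (kern_meas d x).comp ?_
    fun_prop
  have hin : ∀ t : ℝ, IntegrableOn (fun y => kern d x (t • x - y)) B := by
    intro t
    refine ((hC (t • x)).1.const_mul ‖x‖).mono' ?_ (ae_of_all _ fun y => kern_bound d hd x _)
    exact ((kern_meas d x).comp (by fun_prop)).aestronglyMeasurable
  have hprod : Integrable (Function.uncurry fun (t:ℝ) (y : Euc d) => kern d x (t • x - y)) 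
      ((volume.restrict (Set.Ioc (0:ℝ) 1)).prod (volume.restrict B)) := by
    rw [integrable_prod_iff hmeas.aestronglyMeasurable]
    refine ⟨ae_of_all _ hin, ?_⟩
    have : Integrable (fun _ : ℝ => ‖x‖ * C) (volume.restrict (Set.Ioc (0:ℝ) 1)) := integrable_const _
    refine this.mono' ?_ (ae_of_all _ fun t => ?_)
    · exact (hmeas.norm.aestronglyMeasurable).integral_prod_right'
    · rw [Real.norm_of_nonneg (by positivity)]
      calc _ ≤ ∫ y in B, ‖x‖ * (‖t • x - y‖^(d-1))⁻¹ := 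
            integral_mono (hin t).norm ((hC _).1.const_mul _) (fun y => kern_bound d hd x _)
        _ = ‖x‖ * ∫ y in B, (‖t • x - y‖^(d-1))⁻¹ := integral_const_mul _ _
        _ ≤ _ := by gcongr; exact (hC _).2
  rw [intervalIntegral.integral_of_le zero_le_one, integral_integral_swap hprod]
  rw [potB, potB, ← integral_sub (hC' x).1 (hC' 0).1, ← integral_neg]
  apply integral_congr_ae
  have hspan : volume ((Submodule.span ℝ {x} : Submodule ℝ (Euc d)) : Set (Euc d)) = 0 := by
    apply Measure.addHaar_submodule
    intro h
    have h1 : Module.finrank ℝ (Submodule.span ℝ {x} : Submodule ℝ (Euc d)) ≤ 1 := by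
      simpa using finrank_span_le_card (R := ℝ) ({x} : Set (Euc d))
    rw [h, finrank_top, finrank_euclideanSpace_fin] at h1
    omega
  have hae : ∀ᵐ y ∂(volume.restrict B), y ∉ (Submodule.span ℝ {x} : Submodule ℝ (Euc d)) := 
    ae_restrict_of_ae (measure_eq_zero_iff_ae_notMem.1 hspan)
  filter_upwards [hae] with y hy
  have hne : ∀ t : ℝ, t • x - y ≠ 0 := by
    intro t h
    apply hy
    rw [← sub_eq_zero.1 h]
    exact Submodule.smul_mem _ _ (Submodule.mem_span_singleton_self x)
  have hcont : Continuous (fun t : ℝ => -kern d x (t • x - y)) := by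
    unfold kern
    refine Continuous.neg (Continuous.div (by fun_prop) (by fun_prop) ?_)
    intro t
    have := norm_pos_iff.2 (hne t)
    positivity
  have hftc := intervalIntegral.integral_eq_sub_of_hasDerivAt 
    (f := fun t : ℝ => coulombKR d (t • x - y)) (fun t _ => gR_deriv d hd x y t (hne t)) 
    (hcont.intervalIntegrable 0 1)
  simp only [one_smul, zero_smul] at hftc
  rw [← hftc, intervalIntegral.integral_neg, intervalIntegral.integral_of_le zero_le_one]

lemma potB_main (d : ℕ) (hd : 2 ≤ d) (x : Euc d) : 
    potB d 0 ≤ potB d x + volume.real (ball (0:Euc d) 1) * (‖x‖^2/2) ∧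
    (‖x‖ ≤ 1 → potB d 0 = potB d x + volume.real (ball (0:Euc d) 1) * (‖x‖^2/2)) := by
  have hdiff := potB_diff d hd x
  obtain ⟨C, hC0, hC⟩ := unif_bound d hd
  have hlin : ∫ t in (0:ℝ)..1, t * (volume.real (ball (0:Euc d) 1) * ‖x‖^2) = 
      volume.real (ball (0:Euc d) 1) * (‖x‖^2/2) := by
    rw [intervalIntegral.integral_mul_const, integral_id]; ring
  have hmeas : Measurable (Function.uncurry fun (t:ℝ) (y : Euc d) => kern d x (t • x - y)) := by
    refine (kern_meas d x).comp ?_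
    fun_prop
  have hin : ∀ t : ℝ, IntegrableOn (fun y => kern d x (t • x - y)) (closedBall 0 1) := by
    intro t
    refine ((hC (t • x)).1.const_mul ‖x‖).mono' ?_ (ae_of_all _ fun y => kern_bound d hd x _)
    exact ((kern_meas d x).comp (by fun_prop)).aestronglyMeasurable
  have hII : IntervalIntegrable (fun t : ℝ => ∫ y in closedBall (0:Euc d) 1, kern d x (t • x - y)) volume 0 1 := by
    refine (intervalIntegrable_const (c := ‖x‖ * C)).mono_fun' ?_ (ae_of_all _ fun t => ?_)
    · exact (hmeas.aestronglyMeasurable).integral_prod_right'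
    · calc _ ≤ ∫ y in closedBall (0:Euc d) 1, ‖kern d x (t • x - y)‖ := norm_integral_le_integral_norm _
        _ ≤ ∫ y in closedBall (0:Euc d) 1, ‖x‖ * (‖t • x - y‖^(d-1))⁻¹ := 
            integral_mono (hin t).norm ((hC _).1.const_mul _) (fun y => kern_bound d hd x _)
        _ = ‖x‖ * ∫ y in closedBall (0:Euc d) 1, (‖t • x - y‖^(d-1))⁻¹ := integral_const_mul _ _
        _ ≤ ‖x‖ * C := by gcongr; exact (hC _).2
  constructor
  · have := intervalIntegral.integral_mono_on (zero_le_one) hII 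
      ((by fun_prop : Continuous (fun t : ℝ => t * (volume.real (ball (0:Euc d) 1) * ‖x‖^2))).intervalIntegrable 0 1)
      (fun t ht => (kern_ball d hd x t ht.1).1)
    rw [hlin] at this
    linarith
  · intro hx
    have : ∫ t in (0:ℝ)..1, ∫ y in closedBall (0:Euc d) 1, kern d x (t • x - y) = 
       ∫ t in (0:ℝ)..1, t * (volume.real (ball (0:Euc d) 1) * ‖x‖^2) := by
      apply intervalIntegral.integral_congr
      intro t ht
      rw [Set.uIcc_of_le zero_le_one] at ht
      apply (kern_ball d hd x t ht.1).2
      rw [norm_smul, Real.norm_of_nonneg ht.1]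
      nlinarith [ht.1, ht.2, norm_nonneg x]
    rw [hlin] at this
    linarith


lemma frullani_int (a b : ℝ) (ha : 0 < a) (hab : a ≤ b) :
    IntegrableOn (fun x : ℝ => x⁻¹ • (Real.exp (-(a*x)) - Real.exp (-(b*x)))) (Set.Ioi 0) := by
  have h1 : IntegrableOn (fun x : ℝ => (b-a) * Real.exp (-a*x)) (Set.Ioi 0) := 
    (integrableOn_exp_mul_Ioi (by linarith) 0).const_mul _
  refine h1.mono' (by fun_prop) ?_
  filter_upwards [ae_restrict_mem measurableSet_Ioi] with x hx
  have hx : 0 < x := hx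
  have h2 : Real.exp (-(b*x)) = Real.exp (-(a*x)) * Real.exp (-((b-a)*x)) := by
    rw [← Real.exp_add]; ring_nf
  have h3 : 1 - (b-a)*x ≤ Real.exp (-((b-a)*x)) := by
    have := Real.add_one_le_exp (-((b-a)*x)); linarith
  have h4 : Real.exp (-((b-a)*x)) ≤ 1 := Real.exp_le_one_iff.2 (by nlinarith)
  have h5 := Real.exp_pos (-(a*x))
  rw [h2, Real.norm_of_nonneg]
  · rw [smul_eq_mul, inv_mul_le_iff₀ hx, neg_mul]
    nlinarith
  · rw [smul_eq_mul]
    have : 0 ≤ Real.exp (-(a*x)) - Real.exp (-(a*x)) * Real.exp (-((b-a)*x)) := by nlinarith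
    positivity

lemma frullani_int' (a b : ℝ) (ha : 0 < a) (hb : 0 < b) :
    IntegrableOn (fun x : ℝ => x⁻¹ • (Real.exp (-(a*x)) - Real.exp (-(b*x)))) (Set.Ioi 0) := by
  rcases le_total a b with h | h
  · exact frullani_int a b ha h
  · have := (frullani_int b a hb h).neg
    refine this.congr (ae_of_all _ fun x => ?_)
    simp
    ring

lemma mixture (d : ℕ) (hd : 2 ≤ d) : ∃ W c : ℝ → ℝ, Measurable W ∧ Measurable c ∧ (∀ t > 0, 0 < W t) ∧
    ∀ v : Euc d, v ≠ 0 →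
      IntegrableOn (fun t => W t * (Real.exp (-(t*‖v‖^2)) - c t)) (Set.Ioi 0) ∧
      ∫ t in Set.Ioi (0:ℝ), W t * (Real.exp (-(t*‖v‖^2)) - c t) = coulombKR d v ∧
      ∫ t in Set.Ioi (0:ℝ), ‖W t * (Real.exp (-(t*‖v‖^2)) - c t)‖ = ‖coulombKR d v‖ := by
  by_cases h : d = 2
  · subst h
    refine ⟨fun t => 2⁻¹ * t⁻¹, fun t => Real.exp (-t), by fun_prop, by fun_prop, fun t ht => by positivity, 
      fun v hv => ?_⟩
    have hr : 0 < ‖v‖^2 := by have := norm_pos_iff.2 hv; positivity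
    have hi := frullani_int' (‖v‖^2) 1 hr one_pos
    have hF := Frullani.integral_Ioi_eq (f := fun x : ℝ => Real.exp (-x)) (a := ‖v‖^2) (b := 1) (L := 1) (R := 0)
      ((by fun_prop : Continuous (fun x : ℝ => Real.exp (-x))).locallyIntegrable.locallyIntegrableOn _) hr one_pos
      (by
        have : Continuous (fun x : ℝ => Real.exp (-x)) := by fun_prop
        have h := this.tendsto 0
        simp only [neg_zero, Real.exp_zero] at h
        exact h.mono_left nhdsWithin_le_nhds)
      Real.tendsto_exp_neg_atTop_nhds_zero hi
    have hfun : (fun t : ℝ => 2⁻¹ * t⁻¹ * (Real.exp (-(t*‖v‖^2)) - Real.exp (-t))) = 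
        fun t => 2⁻¹ * (t⁻¹ • (Real.exp (-(‖v‖^2*t)) - Real.exp (-(1*t)))) := by
      funext t
      rw [smul_eq_mul, one_mul, mul_comm t]; ring
    have hI : IntegrableOn (fun t : ℝ => 2⁻¹ * t⁻¹ * (Real.exp (-(t*‖v‖^2)) - Real.exp (-t))) (Set.Ioi 0) := by
      rw [hfun]; exact hi.const_mul _
    have hE : ∫ t in Set.Ioi (0:ℝ), 2⁻¹ * t⁻¹ * (Real.exp (-(t*‖v‖^2)) - Real.exp (-t)) = coulombKR 2 v := by
      rw [hfun, integral_const_mul, hF]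
      simp only [coulombKR, if_true]
      rw [one_div, one_div, Real.log_inv, Real.log_inv, Real.log_pow]
      simp
    refine ⟨hI, hE, ?_⟩
    rcases le_total (‖v‖^2) 1 with h1 | h1
    · have hs : ∀ t ∈ Set.Ioi (0:ℝ), 0 ≤ 2⁻¹ * t⁻¹ * (Real.exp (-(t*‖v‖^2)) - Real.exp (-t)) := by
        intro t ht
        have ht : 0 < t := ht
        have : Real.exp (-t) ≤ Real.exp (-(t*‖v‖^2)) := Real.exp_le_exp.2 (by nlinarith)
        exact mul_nonneg (by positivity) (by linarith)
      rw [← hE, Real.norm_of_nonneg (setIntegral_nonneg measurableSet_Ioi hs)]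
      exact setIntegral_congr_fun measurableSet_Ioi fun t ht => Real.norm_of_nonneg (hs t ht)
    · have hs : ∀ t ∈ Set.Ioi (0:ℝ), 2⁻¹ * t⁻¹ * (Real.exp (-(t*‖v‖^2)) - Real.exp (-t)) ≤ 0 := by
        intro t ht
        have ht : 0 < t := ht
        have : Real.exp (-(t*‖v‖^2)) ≤ Real.exp (-t) := Real.exp_le_exp.2 (by nlinarith)
        exact mul_nonpos_of_nonneg_of_nonpos (by positivity) (by linarith)
      rw [← hE, Real.norm_of_nonpos (setIntegral_nonpos measurableSet_Ioi hs), ← integral_neg]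
      exact setIntegral_congr_fun measurableSet_Ioi fun t ht => Real.norm_of_nonpos (hs t ht)
  · obtain ⟨k, rfl⟩ : ∃ k, d = k + 3 := ⟨d-3, by omega⟩
    set a : ℝ := ((k:ℝ)+1)/2 with ha
    have ha0 : 0 < a := by positivity
    have hG := Real.Gamma_pos_of_pos ha0
    set A : ℝ := (((k:ℝ)+1) * Real.Gamma a)⁻¹ with hA
    have hA0 : 0 < A := by positivity
    refine ⟨fun t => A * t^(a-1), fun t => 0, by fun_prop, by fun_prop, fun t ht => by positivity, 
      fun v hv => ?_⟩
    have hv0 := norm_pos_iff.2 hv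
    have hr : 0 < ‖v‖^2 := by positivity
    have hfun : (fun t : ℝ => A * t^(a-1) * (Real.exp (-(t*‖v‖^2)) - 0)) = 
        fun t => A * (t^(a-1) * Real.exp (-(‖v‖^2*t))) := by
      funext t
      rw [sub_zero, mul_comm t]; ring
    have hv2 : (1 / ‖v‖^2) ^ a = (‖v‖^(k+1))⁻¹ := by
      rw [one_div, Real.inv_rpow hr.le, ← Real.rpow_natCast, ← Real.rpow_mul hv0.le, ← Real.rpow_natCast]
      congr 2
      rw [ha]; push_cast; ring
    have hval := Real.integral_rpow_mul_exp_neg_mul_Ioi ha0 hr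
    have hI : IntegrableOn (fun t : ℝ => A * t^(a-1) * (Real.exp (-(t*‖v‖^2)) - 0)) (Set.Ioi 0) := by
      rw [hfun]
      refine Integrable.const_mul ?_ _
      apply Integrable.of_integral_ne_zero
      rw [hval]; positivity
    have hE : ∫ t in Set.Ioi (0:ℝ), A * t^(a-1) * (Real.exp (-(t*‖v‖^2)) - 0) = coulombKR (k+3) v := by
      rw [hfun, integral_const_mul, hval, hv2]
      simp only [coulombKR, if_neg h]
      have e1 : k + 3 - 2 = k + 1 := by omega
      rw [e1, hA]
      push_cast
      have : (k:ℝ) + 3 - 2 = k + 1 := by ring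
      rw [this]
      field_simp
    refine ⟨hI, hE, ?_⟩
    have hs : ∀ t ∈ Set.Ioi (0:ℝ), 0 ≤ A * t^(a-1) * (Real.exp (-(t*‖v‖^2)) - 0) := by
      intro t ht
      have ht : 0 < t := ht
      rw [sub_zero]
      positivity
    rw [← hE, Real.norm_of_nonneg (setIntegral_nonneg measurableSet_Ioi hs)]
    exact setIntegral_congr_fun measurableSet_Ioi fun t ht => Real.norm_of_nonneg (hs t ht)

/-- Gaussian interaction -/
def gaussI (d : ℕ) (t : ℝ) (μ ν : Measure (Euc d)) : ℝ := 
  ∫ q : Euc d × Euc d, Real.exp (-(t*‖q.1 - q.2‖^2)) ∂(μ.prod ν)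

lemma gaussI_fourier (d : ℕ) (t : ℝ) (ht : 0 < t) : ∃ A b : ℝ, 0 < A ∧ 0 < b ∧ 
    ∀ (μ ν : Measure (Euc d)), IsProbabilityMeasure μ → IsProbabilityMeasure ν → 
    Integrable (fun ξ => (Real.exp (-b*‖ξ‖^2) : ℂ) * (charFun μ ξ * (starRingEnd ℂ) (charFun ν ξ))) ∧
    (gaussI d t μ ν : ℂ) = A * 
      ∫ ξ, (Real.exp (-b*‖ξ‖^2) : ℂ) * (charFun μ ξ * (starRingEnd ℂ) (charFun ν ξ)) := by
  set b : ℝ := 1/(4*t) with hb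
  have hb0 : 0 < b := by positivity
  set P : ℝ := (Real.pi / b)^((d:ℝ)/2) with hP
  have hP0 : 0 < P := by positivity
  have hGi : Integrable (fun ξ : Euc d => (Real.exp (-b*‖ξ‖^2) : ℝ)) := by
    have := GaussianFourier.integrable_cexp_neg_mul_sq_norm_add (V := Euc d) (b := (b:ℂ)) (by simpa using hb0) 0 0
    have h2 := this.re
    refine h2.congr (ae_of_all _ fun ξ => ?_)
    simp only [zero_mul, add_zero]
    have h3 : Complex.exp (-(b:ℂ) * (‖ξ‖:ℂ)^2) = ((Real.exp (-b*‖ξ‖^2) : ℝ) : ℂ) := by push_cast; rfl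
    rw [h3]
    exact Complex.ofReal_re _
  have hF : ∀ v : Euc d, ∫ ξ : Euc d, (Real.exp (-b*‖ξ‖^2) : ℂ) * Complex.exp (⟪v, ξ⟫ * Complex.I) = 
      P * Real.exp (-(t*‖v‖^2)) := by
    intro v
    have := GaussianFourier.integral_cexp_neg_mul_sq_norm_add (V := Euc d) (b := (b:ℂ)) (by simpa using hb0) Complex.I v
    have e1 : ∀ ξ : Euc d, (Real.exp (-b*‖ξ‖^2) : ℂ) * Complex.exp (⟪v, ξ⟫ * Complex.I) = 
       Complex.exp (-(b:ℂ) * ‖ξ‖^2 + Complex.I * ⟪v, ξ⟫) := by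
      intro ξ
      rw [Complex.exp_add]
      push_cast
      ring_nf
    simp only [e1]
    rw [this]
    congr 1
    · rw [hP, Complex.ofReal_cpow (by positivity)]
      simp
    · rw [Complex.ofReal_exp]
      congr 1
      rw [Complex.I_sq, hb]
      push_cast
      have : (t:ℂ) ≠ 0 := by exact_mod_cast ht.ne'
      field_simp
  refine ⟨P⁻¹, b, by positivity, hb0, fun μ ν hμ hν => ?_⟩
  set f : (Euc d × Euc d) → Euc d → ℂ := fun q ξ => 
    (Real.exp (-b*‖ξ‖^2) : ℂ) * Complex.exp (⟪q.1 - q.2, ξ⟫ * Complex.I) with hf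
  have hfi : Integrable (Function.uncurry f) ((μ.prod ν).prod volume) := by
    have h1 : Integrable (fun p : (Euc d × Euc d) × Euc d => Real.exp (-b*‖p.2‖^2)) ((μ.prod ν).prod volume) := 
      hGi.comp_snd _
    refine h1.mono' ?_ (ae_of_all _ fun p => ?_)
    · apply Continuous.aestronglyMeasurable
      simp only [hf, Function.uncurry_def]
      fun_prop
    · simp only [hf, Function.uncurry_def, norm_mul, Complex.norm_exp_ofReal_mul_I, mul_one]
      rw [Complex.norm_real, Real.norm_of_nonneg (Real.exp_pos _).le]
  have hin : ∀ ξ, ∫ q, f q ξ ∂(μ.prod ν) = (Real.exp (-b*‖ξ‖^2) : ℂ) * (charFun μ ξ * (starRingEnd ℂ) (charFun ν ξ)) := by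
    intro ξ
    simp only [hf]
    rw [integral_const_mul]
    congr 1
    have : ∀ q : Euc d × Euc d, Complex.exp (⟪q.1 - q.2, ξ⟫ * Complex.I) = 
      Complex.exp (⟪q.1, ξ⟫ * Complex.I) * (starRingEnd ℂ) (Complex.exp (⟪q.2, ξ⟫ * Complex.I)) := by
      intro q
      rw [← Complex.exp_conj, ← Complex.exp_add, inner_sub_left]
      simp
      ring_nf
    simp only [this]
    rw [integral_prod_mul (μ := μ) (ν := ν) (fun x : Euc d => Complex.exp (⟪x, ξ⟫ * Complex.I)) 
      (fun y : Euc d => (starRingEnd ℂ) (Complex.exp (⟪y, ξ⟫ * Complex.I))), integral_conj]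
    rfl
  constructor
  · have := hfi.integral_prod_right
    simpa only [Function.uncurry_apply_pair, hin] using this
  · have hsw := integral_integral_swap hfi
    simp only [hin] at hsw
    rw [← hsw]
    simp only [hf, hF]
    rw [integral_const_mul, integral_complex_ofReal]
    have : (P:ℂ) ≠ 0 := by exact_mod_cast hP0.ne'
    push_cast
    rw [inv_mul_cancel_left₀ this, gaussI]

lemma gaussI_pd (d : ℕ) (t : ℝ) (ht : 0 < t) (μ ν : Measure (Euc d)) [hμ : IsProbabilityMeasure μ]
    [hν : IsProbabilityMeasure ν] :
    0 ≤ gaussI d t μ μ - 2 * gaussI d t μ ν + gaussI d t ν ν ∧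
    (gaussI d t μ μ - 2 * gaussI d t μ ν + gaussI d t ν ν = 0 → μ = ν) := by
  obtain ⟨A, b, hA, hb, H⟩ := gaussI_fourier d t ht
  have hsym : gaussI d t μ ν = gaussI d t ν μ := by
    unfold gaussI
    rw [← integral_prod_swap]
    simp only [Prod.fst_swap, Prod.snd_swap, norm_sub_rev]
  obtain ⟨i1, e1⟩ := H μ μ hμ hμ
  obtain ⟨i2, e2⟩ := H μ ν hμ hν
  obtain ⟨i3, e3⟩ := H ν μ hν hμ
  obtain ⟨i4, e4⟩ := H ν ν hν hν
  set D : Euc d → ℝ := fun ξ => Real.exp (-b*‖ξ‖^2) * ‖charFun μ ξ - charFun ν ξ‖^2 with hD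
  have hpt : ∀ ξ, (D ξ : ℂ) = 
    ((Real.exp (-b*‖ξ‖^2) : ℂ) * (charFun μ ξ * (starRingEnd ℂ) (charFun μ ξ)) 
    - (Real.exp (-b*‖ξ‖^2) : ℂ) * (charFun μ ξ * (starRingEnd ℂ) (charFun ν ξ)))
    - ((Real.exp (-b*‖ξ‖^2) : ℂ) * (charFun ν ξ * (starRingEnd ℂ) (charFun μ ξ)) 
    - (Real.exp (-b*‖ξ‖^2) : ℂ) * (charFun ν ξ * (starRingEnd ℂ) (charFun ν ξ))) := by
    intro ξ
    simp only [hD]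
    have : ((‖charFun μ ξ - charFun ν ξ‖^2 : ℝ) : ℂ) = 
      (charFun μ ξ - charFun ν ξ) * (starRingEnd ℂ) (charFun μ ξ - charFun ν ξ) := by
      rw [Complex.mul_conj, Complex.normSq_eq_norm_sq]
    rw [Complex.ofReal_mul, this, map_sub]
    ring
  have hDi : Integrable D := by
    have := ((i1.sub i2).sub (i3.sub i4)).re
    refine this.congr (ae_of_all _ fun ξ => ?_)
    simp only [Pi.sub_apply]
    rw [← hpt]; simp
  have hval : gaussI d t μ μ - 2 * gaussI d t μ ν + gaussI d t ν ν = A * ∫ ξ, D ξ := by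
    have : ((gaussI d t μ μ - 2 * gaussI d t μ ν + gaussI d t ν ν : ℝ) : ℂ) = ((A * ∫ ξ, D ξ : ℝ) : ℂ) := by
      rw [Complex.ofReal_mul, ← integral_complex_ofReal]
      simp only [hpt]
      have E := integral_sub (i1.sub i2) (i3.sub i4)
      simp only [Pi.sub_apply] at E
      rw [E, integral_sub i1 i2, integral_sub i3 i4, mul_sub, mul_sub, mul_sub,
        ← e1, ← e2, ← e3, ← e4, hsym]
      push_cast
      ring
    exact_mod_cast this
  have hD0 : ∀ ξ, 0 ≤ D ξ := by intro ξ; simp only [hD]; positivity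
  rw [hval]
  refine ⟨mul_nonneg hA.le (integral_nonneg hD0), fun h => ?_⟩
  have h0 : ∫ ξ, D ξ = 0 := by
    rcases mul_eq_zero.1 h with h | h
    · exact absurd h hA.ne'
    · exact h
  rw [integral_eq_zero_iff_of_nonneg hD0 hDi] at h0
  have hc : Continuous D := by
    have c1 := continuous_charFun (μ := μ)
    have c2 := continuous_charFun (μ := ν)
    simp only [hD]
    fun_prop
  have h1 : D = fun _ => 0 := (hc.ae_eq_iff_eq (μ := volume) continuous_const).1 h0
  apply Measure.ext_of_charFun
  funext ξ
  have h2 := congrFun h1 ξ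
  simp only [hD] at h2
  have h3 := (Real.exp_pos (-b*‖ξ‖^2)).ne'
  have h4 : ‖charFun μ ξ - charFun ν ξ‖^2 = 0 := by
    rcases mul_eq_zero.1 h2 with h | h
    · exact absurd h h3
    · exact h
  exact sub_eq_zero.1 (norm_eq_zero.1 (pow_eq_zero_iff (two_ne_zero) |>.1 h4))

lemma coulomb_mix (d : ℕ) (W c : ℝ → ℝ) (hW : Measurable W) (hc : Measurable c)
    (H : ∀ v : Euc d, v ≠ 0 →
      IntegrableOn (fun t => W t * (Real.exp (-(t*‖v‖^2)) - c t)) (Set.Ioi 0) ∧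
      ∫ t in Set.Ioi (0:ℝ), W t * (Real.exp (-(t*‖v‖^2)) - c t) = coulombKR d v ∧
      ∫ t in Set.Ioi (0:ℝ), ‖W t * (Real.exp (-(t*‖v‖^2)) - c t)‖ = ‖coulombKR d v‖)
    (μ ν : Measure (Euc d)) [hμ : IsProbabilityMeasure μ] [hν : IsProbabilityMeasure ν]
    (hne : ∀ᵐ q ∂(μ.prod ν), q.1 - q.2 ≠ 0)
    (hi : Integrable (fun q : Euc d × Euc d => coulombKR d (q.1 - q.2)) (μ.prod ν)) :
    IntegrableOn (fun t => W t * (gaussI d t μ ν - c t)) (Set.Ioi 0) ∧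
    ∫ q, coulombKR d (q.1 - q.2) ∂(μ.prod ν) = ∫ t in Set.Ioi (0:ℝ), W t * (gaussI d t μ ν - c t) := by
  set f : (Euc d × Euc d) → ℝ → ℝ := fun q t => W t * (Real.exp (-(t*‖q.1-q.2‖^2)) - c t) with hf
  have hm : Measurable (Function.uncurry f) := by
    simp only [hf, Function.uncurry_def]
    fun_prop
  have hfi : Integrable (Function.uncurry f) ((μ.prod ν).prod (volume.restrict (Set.Ioi (0:ℝ)))) := by
    rw [integrable_prod_iff hm.aestronglyMeasurable]
    constructor
    · filter_upwards [hne] with q hq using (H _ hq).1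
    · refine hi.norm.congr ?_
      filter_upwards [hne] with q hq
      exact (H _ hq).2.2.symm
  have hin : ∀ t ∈ Set.Ioi (0:ℝ), ∫ q, f q t ∂(μ.prod ν) = W t * (gaussI d t μ ν - c t) := by
    intro t ht
    have ht : 0 < t := ht
    simp only [hf]
    rw [integral_const_mul, integral_sub, gaussI]
    · simp
    · have : Integrable (fun _ : Euc d × Euc d => (1:ℝ)) (μ.prod ν) := integrable_const _
      refine this.mono' (by fun_prop) (ae_of_all _ fun q => ?_)
      rw [Real.norm_of_nonneg (Real.exp_pos _).le]
      exact Real.exp_le_one_iff.2 (neg_nonpos.2 (by positivity))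
    · exact integrable_const _
  constructor
  · have := hfi.integral_prod_right
    refine this.congr ?_
    filter_upwards [ae_restrict_mem measurableSet_Ioi] with t ht
    exact hin t ht
  · rw [← setIntegral_congr_fun measurableSet_Ioi hin, ← integral_integral_swap hfi]
    apply integral_congr_ae
    filter_upwards [hne] with q hq
    exact (H _ hq).2.1.symm

lemma coulomb_pd (d : ℕ) (hd : 2 ≤ d) (μ ν : Measure (Euc d)) [hμ : IsProbabilityMeasure μ] [hν : IsProbabilityMeasure ν]
    (n1 : ∀ᵐ q ∂(μ.prod μ), q.1 - q.2 ≠ 0)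
    (n2 : ∀ᵐ q ∂(μ.prod ν), q.1 - q.2 ≠ 0)
    (n3 : ∀ᵐ q ∂(ν.prod ν), q.1 - q.2 ≠ 0)
    (i1 : Integrable (fun q : Euc d × Euc d => coulombKR d (q.1 - q.2)) (μ.prod μ))
    (i2 : Integrable (fun q : Euc d × Euc d => coulombKR d (q.1 - q.2)) (μ.prod ν))
    (i3 : Integrable (fun q : Euc d × Euc d => coulombKR d (q.1 - q.2)) (ν.prod ν)) :
    0 ≤ ∫ q, coulombKR d (q.1 - q.2) ∂(μ.prod μ) - 2 * ∫ q, coulombKR d (q.1 - q.2) ∂(μ.prod ν)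
      + ∫ q, coulombKR d (q.1 - q.2) ∂(ν.prod ν) ∧
    (∫ q, coulombKR d (q.1 - q.2) ∂(μ.prod μ) - 2 * ∫ q, coulombKR d (q.1 - q.2) ∂(μ.prod ν)
      + ∫ q, coulombKR d (q.1 - q.2) ∂(ν.prod ν) = 0 → μ = ν) := by
  obtain ⟨W, c, hW, hc, hpos, H⟩ := mixture d hd
  obtain ⟨j1, k1⟩ := coulomb_mix d W c hW hc H μ μ n1 i1
  obtain ⟨j2, k2⟩ := coulomb_mix d W c hW hc H μ ν n2 i2
  obtain ⟨j3, k3⟩ := coulomb_mix d W c hW hc H ν ν n3 i3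
  set D : ℝ → ℝ := fun t => W t * (gaussI d t μ μ - 2 * gaussI d t μ ν + gaussI d t ν ν) with hD
  have hDeq : D = fun t => (W t * (gaussI d t μ μ - c t) - 2 * (W t * (gaussI d t μ ν - c t))) 
      + W t * (gaussI d t ν ν - c t) := by
    funext t; simp only [hD]; ring
  have hDi : IntegrableOn D (Set.Ioi 0) := by
    rw [hDeq]; exact (j1.sub (j2.const_mul 2)).add j3
  have hval : ∫ q, coulombKR d (q.1 - q.2) ∂(μ.prod μ) - 2 * ∫ q, coulombKR d (q.1 - q.2) ∂(μ.prod ν)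
      + ∫ q, coulombKR d (q.1 - q.2) ∂(ν.prod ν) = ∫ t in Set.Ioi (0:ℝ), D t := by
    have E := integral_add (j1.sub (j2.const_mul 2)) j3
    simp only [Pi.sub_apply] at E
    rw [hDeq]
    rw [E, integral_sub j1 (j2.const_mul 2), integral_const_mul,
      k1, k2, k3]
  have hD0 : ∀ t ∈ Set.Ioi (0:ℝ), 0 ≤ D t := fun t ht => 
    mul_nonneg (hpos t ht).le (gaussI_pd d t ht μ ν).1
  rw [hval]
  refine ⟨setIntegral_nonneg measurableSet_Ioi hD0, fun h => ?_⟩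
  rw [setIntegral_eq_zero_iff_of_nonneg_ae ((ae_restrict_iff' measurableSet_Ioi).2 (ae_of_all _ hD0)) hDi] at h
  have hne : (ae (volume.restrict (Set.Ioi (0:ℝ)))).NeBot := by
    rw [ae_neBot]
    intro h0
    have := Measure.restrict_eq_zero.1 h0
    simp at this
  obtain ⟨t, h1, h2⟩ := (h.and (ae_restrict_mem measurableSet_Ioi)).exists
  have h3 : W t * (gaussI d t μ μ - 2 * gaussI d t μ ν + gaussI d t ν ν) = 0 := h1
  rcases mul_eq_zero.1 h3 with h | h
  · exact absurd h (hpos t h2).ne'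
  · exact (gaussI_pd d t h2 μ ν).2 h


/-- real valued integrand of the energy -/
def enF (d : ℕ) (q : Euc d × Euc d) : ℝ := coulombKR d (q.1 - q.2) + (‖q.1‖^2 + ‖q.2‖^2) / 2

lemma enF_meas (d : ℕ) : Measurable (enF d) := by
  unfold enF
  have := gR_meas d
  fun_prop

lemma gR2_meas (d : ℕ) : Measurable (fun q : Euc d × Euc d => coulombKR d (q.1 - q.2)) := by
  have := gR_meas d
  fun_prop

lemma enF_lower (d : ℕ) (hd : 2 ≤ d) (q : Euc d × Euc d) :
    (‖q.1‖^2 + ‖q.2‖^2) / 4 ≤ enF d q + Real.log 8 := by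
  have h8 : 0 ≤ Real.log 8 := Real.log_nonneg (by norm_num)
  unfold enF coulombKR
  split_ifs with h
  · have hr : ‖q.1 - q.2‖^2 ≤ 2 * (‖q.1‖^2 + ‖q.2‖^2) := by
      have := norm_sub_le q.1 q.2
      have h0 := norm_nonneg (q.1 - q.2)
      nlinarith [sq_nonneg (‖q.1‖ - ‖q.2‖)]
    rw [one_div, Real.log_inv]
    rcases eq_or_lt_of_le (norm_nonneg (q.1 - q.2)) with h0 | h0
    · rw [← h0, Real.log_zero]
      nlinarith [sq_nonneg ‖q.1‖, sq_nonneg ‖q.2‖]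
    · have h1 := Real.log_le_sub_one_of_pos (show 0 < ‖q.1 - q.2‖^2 / 8 by positivity)
      rw [Real.log_div (by positivity) (by norm_num), Real.log_pow] at h1
      push_cast at h1
      nlinarith [sq_nonneg ‖q.1‖, sq_nonneg ‖q.2‖]
  · have h3 : (2:ℝ) ≤ d := by exact_mod_cast hd
    have : 0 ≤ 1 / (((d : ℝ) - 2) * ‖q.1 - q.2‖ ^ ((d : ℕ) - 2)) := by
      have : 0 ≤ (d:ℝ) - 2 := by linarith
      positivity
    nlinarith [sq_nonneg ‖q.1‖, sq_nonneg ‖q.2‖]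

lemma kern_ne (d : ℕ) (q : Euc d × Euc d) (h : q.1 - q.2 ≠ 0) :
    coulombK d (q.1 - q.2) + (((‖q.1‖^2 + ‖q.2‖^2) / 2 : ℝ) : EReal) = ((enF d q : ℝ) : EReal) := by
  unfold coulombK enF coulombKR
  rw [if_neg h]
  split_ifs <;> rw [EReal.coe_add]

lemma kern_eq (d : ℕ) (q : Euc d × Euc d) (h : q.1 - q.2 = 0) :
    coulombK d (q.1 - q.2) + (((‖q.1‖^2 + ‖q.2‖^2) / 2 : ℝ) : EReal) = ⊤ := by
  unfold coulombK
  rw [if_pos h, EReal.top_add_coe]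

lemma posP_coe (x : ℝ) : posP (x : EReal) = ENNReal.ofReal x := by
  unfold posP
  rw [if_neg (EReal.coe_ne_top x), EReal.toReal_coe]

lemma energy_real (d : ℕ) (μ : Measure (Euc d)) [IsProbabilityMeasure μ]
    (n1 : ∀ᵐ q ∂(μ.prod μ), q.1 - q.2 ≠ 0) (i1 : Integrable (enF d) (μ.prod μ)) :
    energy d (fun x => ‖x‖^2) μ = ((∫ q, enF d q ∂(μ.prod μ) : ℝ) : EReal) := by
  unfold energy
  have e1 : ∫⁻ q : Euc d × Euc d,
      posP (coulombK d (q.1 - q.2) + (((‖q.1‖^2 + ‖q.2‖^2) / 2 : ℝ) : EReal)) ∂(μ.prod μ) =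
      ∫⁻ q, ENNReal.ofReal (enF d q) ∂(μ.prod μ) := by
    refine lintegral_congr_ae ?_
    filter_upwards [n1] with q hq
    rw [kern_ne d q hq, posP_coe]
  have e2 : ∫⁻ q : Euc d × Euc d,
      posP (-(coulombK d (q.1 - q.2) + (((‖q.1‖^2 + ‖q.2‖^2) / 2 : ℝ) : EReal))) ∂(μ.prod μ) =
      ∫⁻ q, ENNReal.ofReal (-enF d q) ∂(μ.prod μ) := by
    refine lintegral_congr_ae ?_
    filter_upwards [n1] with q hq
    rw [kern_ne d q hq, ← EReal.coe_neg, posP_coe]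
  rw [e1, e2, integral_eq_lintegral_pos_part_sub_lintegral_neg_part i1]
  have f1 : ∫⁻ q, ENNReal.ofReal (enF d q) ∂(μ.prod μ) ≠ ⊤ := i1.lintegral_lt_top.ne
  have f2 : ∫⁻ q, ENNReal.ofReal (-enF d q) ∂(μ.prod μ) ≠ ⊤ := i1.neg.lintegral_lt_top.ne
  rw [EReal.coe_sub, EReal.coe_ennreal_toReal f1, EReal.coe_ennreal_toReal f2]

lemma energy_fin (d : ℕ) (hd : 2 ≤ d) (μ : Measure (Euc d)) [IsProbabilityMeasure μ]
    (h : energy d (fun x => ‖x‖^2) μ ≠ ⊤) :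
    (∀ᵐ q ∂(μ.prod μ), q.1 - q.2 ≠ 0) ∧ Integrable (enF d) (μ.prod μ) := by
  unfold energy at h
  set P := ∫⁻ q : Euc d × Euc d,
      posP (coulombK d (q.1 - q.2) + (((‖q.1‖^2 + ‖q.2‖^2) / 2 : ℝ) : EReal)) ∂(μ.prod μ) with hP
  set N := ∫⁻ q : Euc d × Euc d,
      posP (-(coulombK d (q.1 - q.2) + (((‖q.1‖^2 + ‖q.2‖^2) / 2 : ℝ) : EReal))) ∂(μ.prod μ) with hN
  have hlow : ∀ q : Euc d × Euc d, -enF d q ≤ Real.log 8 := by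
    intro q
    have := enF_lower d hd q
    nlinarith [sq_nonneg ‖q.1‖, sq_nonneg ‖q.2‖]
  have hNf : N ≠ ⊤ := by
    have : N ≤ ∫⁻ q : Euc d × Euc d, ENNReal.ofReal (Real.log 8) ∂(μ.prod μ) := by
      refine lintegral_mono fun q => ?_
      by_cases hq : q.1 - q.2 = 0
      · rw [kern_eq d q hq]; simp [posP]
      · rw [kern_ne d q hq, ← EReal.coe_neg, posP_coe]
        exact ENNReal.ofReal_le_ofReal (hlow q)
    refine ne_top_of_le_ne_top ?_ this
    simp
  have hPf : P ≠ ⊤ := by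
    intro hp
    apply h
    rw [hp, ← EReal.coe_ennreal_toReal hNf]
    exact EReal.top_sub_coe _
  have hms : MeasurableSet {q : Euc d × Euc d | q.1 - q.2 = 0} :=
    (isClosed_eq (by fun_prop) (by fun_prop)).measurableSet
  constructor
  · have h1 : ∫⁻ q, ({q : Euc d × Euc d | q.1 - q.2 = 0}.indicator (fun _ => ⊤) q : ℝ≥0∞) ∂(μ.prod μ) ≤ P := by
      refine lintegral_mono fun q => ?_
      by_cases hq : q.1 - q.2 = 0
      · rw [kern_eq d q hq]; simp [posP]
      · rw [Set.indicator_of_notMem (by exact hq)]; simp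
    rw [lintegral_indicator_const hms] at h1
    have h2 : (μ.prod μ) {q : Euc d × Euc d | q.1 - q.2 = 0} = 0 := by
      by_contra h0
      rw [ENNReal.top_mul h0] at h1
      exact hPf (top_le_iff.1 h1)
    rw [ae_iff]
    simpa using h2
  · refine ⟨(enF_meas d).aestronglyMeasurable, ?_⟩
    have h1 : ∫⁻ q, ‖enF d q‖ₑ ∂(μ.prod μ) ≤ ∫⁻ q : Euc d × Euc d,
      (posP (coulombK d (q.1 - q.2) + (((‖q.1‖^2 + ‖q.2‖^2) / 2 : ℝ) : EReal)) + ENNReal.ofReal (Real.log 8)) ∂(μ.prod μ) := by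
      refine lintegral_mono fun q => ?_
      by_cases hq : q.1 - q.2 = 0
      · rw [kern_eq d q hq]; simp [posP]
      · rw [kern_ne d q hq, posP_coe, ← ofReal_norm, Real.norm_eq_abs]
        rcases le_total 0 (enF d q) with h0 | h0
        · rw [abs_of_nonneg h0]; exact le_self_add
        · rw [abs_of_nonpos h0]
          exact (ENNReal.ofReal_le_ofReal (hlow q)).trans le_add_self
    rw [lintegral_add_right _ measurable_const, ← hP] at h1
    refine lt_of_le_of_lt h1 ?_
    simp [hPf.lt_top]

lemma enF_split (d : ℕ) (hd : 2 ≤ d) (μ : Measure (Euc d)) [IsProbabilityMeasure μ]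
    (i1 : Integrable (enF d) (μ.prod μ)) :
    Integrable (fun x => ‖x‖^2) μ ∧ Integrable (fun q => coulombKR d (q.1 - q.2)) (μ.prod μ) := by
  have h1 : Integrable (fun q : Euc d × Euc d => ‖q.1‖^2) (μ.prod μ) := by
    have : Integrable (fun q => 4 * (enF d q + Real.log 8)) (μ.prod μ) :=
      (i1.add (integrable_const _)).const_mul 4
    refine this.mono' (by fun_prop) (ae_of_all _ fun q => ?_)
    rw [Real.norm_of_nonneg (by positivity)]
    have := enF_lower d hd q
    nlinarith [sq_nonneg ‖q.2‖]
  have h2 : Integrable (fun x : Euc d => ‖x‖^2) μ := by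
    have hmp : MeasurePreserving Prod.fst (μ.prod μ) μ := measurePreserving_fst
    exact (hmp.integrable_comp (g := fun x : Euc d => ‖x‖^2) (by fun_prop)).1 h1
  refine ⟨h2, ?_⟩
  have h3 : Integrable (fun q : Euc d × Euc d => ‖q.2‖^2) (μ.prod μ) := h2.comp_snd μ
  refine (i1.sub ((h1.add h3).div_const 2)).congr (ae_of_all _ fun q => ?_)
  simp [enF]

lemma enF_integral (d : ℕ) (μ : Measure (Euc d)) [IsProbabilityMeasure μ]
    (h2 : Integrable (fun x => ‖x‖^2) μ)
    (hg : Integrable (fun q => coulombKR d (q.1 - q.2)) (μ.prod μ)) :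
    Integrable (enF d) (μ.prod μ) ∧
    ∫ q, enF d q ∂(μ.prod μ) = ∫ q, coulombKR d (q.1 - q.2) ∂(μ.prod μ) + ∫ x, ‖x‖^2 ∂μ := by
  have h1 : Integrable (fun q : Euc d × Euc d => ‖q.1‖^2) (μ.prod μ) := h2.comp_fst μ
  have h3 : Integrable (fun q : Euc d × Euc d => ‖q.2‖^2) (μ.prod μ) := h2.comp_snd μ
  have e1 : ∫ q : Euc d × Euc d, ‖q.1‖^2 ∂(μ.prod μ) = ∫ x, ‖x‖^2 ∂μ := by
    have := integral_fun_fst (μ := μ) (ν := μ) (fun x : Euc d => ‖x‖^2)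
    simpa using this
  have e2 : ∫ q : Euc d × Euc d, ‖q.2‖^2 ∂(μ.prod μ) = ∫ x, ‖x‖^2 ∂μ := by
    have := integral_fun_snd (μ := μ) (ν := μ) (fun x : Euc d => ‖x‖^2)
    simpa using this
  refine ⟨hg.add ((h1.add h3).div_const 2), ?_⟩
  unfold enF
  have E := integral_add hg ((h1.add h3).div_const 2)
  simp only [Pi.add_apply] at E
  rw [E, integral_div, integral_add h1 h3, e1, e2]
  ring

/-! the uniform measure -/

lemma ub_prob (d : ℕ) (_hd : 2 ≤ d) : IsProbabilityMeasure (uniformBall d 0) := by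
  have h0 : volume (closedBall (0:Euc d) 1) ≠ 0 := (measure_closedBall_pos volume _ one_pos).ne'
  have h1 : volume (closedBall (0:Euc d) 1) ≠ ⊤ := measure_closedBall_lt_top.ne
  refine ⟨?_⟩
  unfold uniformBall
  rw [Measure.smul_apply, Measure.restrict_apply_univ, smul_eq_mul, ENNReal.inv_mul_cancel h0 h1]

lemma ub_integral (d : ℕ) (hd : 2 ≤ d) (f : Euc d → ℝ) :
    ∫ x, f x ∂(uniformBall d 0) = (volume.real (ball (0:Euc d) 1))⁻¹ * ∫ x in closedBall 0 1, f x := by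
  have := euc_nontrivial d hd
  unfold uniformBall
  rw [integral_smul_measure, Measure.addHaar_closedBall_eq_addHaar_ball, ENNReal.toReal_inv, smul_eq_mul]
  rfl

lemma ub_integrable (d : ℕ) (f : Euc d → ℝ) (h : IntegrableOn f (closedBall 0 1)) :
    Integrable f (uniformBall d 0) := by
  unfold uniformBall
  have h0 : volume (closedBall (0:Euc d) 1) ≠ 0 := (measure_closedBall_pos volume _ one_pos).ne'
  exact Integrable.smul_measure h (ENNReal.inv_ne_top.2 h0)

lemma ub_ae (d : ℕ) : ∀ᵐ x ∂(uniformBall d 0), ‖x‖ ≤ 1 := by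
  unfold uniformBall
  apply Measure.ae_smul_measure
  filter_upwards [ae_restrict_mem measurableSet_closedBall] with x hx
  simpa using hx

lemma ub_point (d : ℕ) (hd : 2 ≤ d) (x : Euc d) : uniformBall d 0 {x} = 0 := by
  have := euc_nontrivial d hd
  unfold uniformBall
  rw [Measure.smul_apply, smul_eq_mul]
  have : (volume.restrict (closedBall (0:Euc d) 1)) {x} = 0 :=
    le_antisymm ((Measure.restrict_apply_le _ _).trans (measure_singleton x).le) bot_le
  rw [this, mul_zero]

lemma ub_diag (d : ℕ) (hd : 2 ≤ d) (μ : Measure (Euc d)) [IsProbabilityMeasure μ] :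
    ∀ᵐ q ∂(μ.prod (uniformBall d 0)), q.1 - q.2 ≠ 0 := by
  have := ub_prob d hd
  have hms : MeasurableSet {q : Euc d × Euc d | q.1 - q.2 = 0} :=
    (isClosed_eq (by fun_prop) (by fun_prop)).measurableSet
  have h2 : (μ.prod (uniformBall d 0)) {q : Euc d × Euc d | q.1 - q.2 = 0} = 0 := by
    rw [Measure.measure_prod_null hms]
    refine ae_of_all _ fun x => ?_
    have : (Prod.mk x ⁻¹' {q : Euc d × Euc d | q.1 - q.2 = 0}) = {x} := by
      ext y; simp [sub_eq_zero, eq_comm]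
    show uniformBall d 0 _ = 0
    rw [this, ub_point d hd]
  rw [ae_iff]
  simpa using h2

lemma ub_cross (d : ℕ) (hd : 2 ≤ d) (μ : Measure (Euc d)) [IsProbabilityMeasure μ]
    (h2 : Integrable (fun x => ‖x‖^2) μ) :
    Integrable (fun q => coulombKR d (q.1 - q.2)) (μ.prod (uniformBall d 0)) ∧
    Integrable (potB d) μ ∧
    ∫ q, coulombKR d (q.1 - q.2) ∂(μ.prod (uniformBall d 0)) =
      (volume.real (ball (0:Euc d) 1))⁻¹ * ∫ x, potB d x ∂μ := by
  have := ub_prob d hd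
  have hv : 0 < volume.real (ball (0:Euc d) 1) := 
    ENNReal.toReal_pos (measure_ball_pos volume _ one_pos).ne' measure_ball_lt_top.ne
  obtain ⟨C, hC, hb⟩ := potB_int d hd
  have hI : Integrable (fun q : Euc d × Euc d => coulombKR d (q.1 - q.2)) (μ.prod (uniformBall d 0)) := by
    rw [integrable_prod_iff (gR2_meas d).aestronglyMeasurable]
    refine ⟨ae_of_all _ fun x => ub_integrable d _ (hb x).1, ?_⟩
    have hB : Integrable (fun x : Euc d => (volume.real (ball (0:Euc d) 1))⁻¹ * (C * (1 + ‖x‖^2))) μ :=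
      (((integrable_const _).add h2).const_mul _).const_mul _
    refine hB.mono' ?_ (ae_of_all _ fun x => ?_)
    · exact (gR2_meas d).norm.aestronglyMeasurable.integral_prod_right'
    · rw [Real.norm_of_nonneg (integral_nonneg fun _ => norm_nonneg _), ub_integral d hd]
      exact mul_le_mul_of_nonneg_left (hb x).2 (by positivity)
  have e : ∀ x, ∫ y, coulombKR d (x - y) ∂(uniformBall d 0) = (volume.real (ball (0:Euc d) 1))⁻¹ * potB d x :=
    fun x => ub_integral d hd _
  refine ⟨hI, ?_, ?_⟩
  · have := hI.integral_prod_left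
    simp only [e] at this
    refine (this.const_mul (volume.real (ball (0:Euc d) 1))).congr (ae_of_all _ fun x => ?_)
    field_simp
  · rw [integral_prod _ hI]
    simp only [e]
    rw [integral_const_mul]

lemma energy_main (d : ℕ) (hd : 2 ≤ d) :
    ∃ e₀ : ℝ, energy d (fun x => ‖x‖^2) (uniformBall d 0) = (e₀ : EReal) ∧
    ∀ μ : Measure (Euc d), IsProbabilityMeasure μ → energy d (fun x => ‖x‖^2) μ ≠ ⊤ →
      ∃ e : ℝ, energy d (fun x => ‖x‖^2) μ = (e : EReal) ∧ e₀ ≤ e ∧ (e ≤ e₀ → μ = uniformBall d 0) := by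
  have hp := ub_prob d hd
  have hv : 0 < volume.real (ball (0:Euc d) 1) := 
    ENNReal.toReal_pos (measure_ball_pos volume _ one_pos).ne' measure_ball_lt_top.ne
  set v := volume.real (ball (0:Euc d) 1) with hvdef
  have h20 : Integrable (fun x => ‖x‖^2) (uniformBall d 0) := by
    refine (integrable_const (1:ℝ)).mono' (by fun_prop) ?_
    filter_upwards [ub_ae d] with x hx
    rw [Real.norm_of_nonneg (by positivity)]
    nlinarith [norm_nonneg x]
  obtain ⟨c1, c2, c3⟩ := ub_cross d hd (uniformBall d 0) h20
  obtain ⟨s1, s2⟩ := enF_integral d _ h20 c1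
  refine ⟨_, energy_real d _ (ub_diag d hd _) s1, ?_⟩
  intro μ hμ hfin
  obtain ⟨n1, i1⟩ := energy_fin d hd μ hfin
  obtain ⟨m2, mg⟩ := enF_split d hd μ i1
  obtain ⟨-, t2⟩ := enF_integral d μ m2 mg
  obtain ⟨b1, b2, b3⟩ := ub_cross d hd μ m2
  obtain ⟨p1, p2⟩ := coulomb_pd d hd μ (uniformBall d 0) n1 (ub_diag d hd _) (ub_diag d hd _) mg b1 c1
  refine ⟨_, energy_real d _ n1 i1, ?_⟩
  rw [t2, s2]
  -- the linear term
  have L1 : potB d 0 ≤ ∫ x, potB d x ∂μ + v * ((∫ x, ‖x‖^2 ∂μ) / 2) := by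
    have E : ∫ x, (potB d x + v * (‖x‖^2/2)) ∂μ = ∫ x, potB d x ∂μ + v * ((∫ x, ‖x‖^2 ∂μ) / 2) := by
      rw [integral_add b2 ((m2.div_const 2).const_mul v), integral_const_mul, integral_div]
    rw [← E]
    have := integral_mono (μ := μ) (integrable_const (potB d 0)) (b2.add ((m2.div_const 2).const_mul v))
      (fun x => (potB_main d hd x).1)
    simpa using this
  have L2 : potB d 0 = ∫ x, potB d x ∂(uniformBall d 0) + v * ((∫ x, ‖x‖^2 ∂(uniformBall d 0)) / 2) := by
    have E : ∫ x, (potB d x + v * (‖x‖^2/2)) ∂(uniformBall d 0) =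
        ∫ x, potB d x ∂(uniformBall d 0) + v * ((∫ x, ‖x‖^2 ∂(uniformBall d 0)) / 2) := by
      rw [integral_add c2 ((h20.div_const 2).const_mul v), integral_const_mul, integral_div]
    rw [← E]
    have : ∫ x, (potB d x + v * (‖x‖^2/2)) ∂(uniformBall d 0) = ∫ x, potB d 0 ∂(uniformBall d 0) := by
      refine integral_congr_ae ?_
      filter_upwards [ub_ae d] with x hx
      exact ((potB_main d hd x).2 hx).symm
    rw [this]; simp
  have M1 : v⁻¹ * potB d 0 ≤ v⁻¹ * ∫ x, potB d x ∂μ + (∫ x, ‖x‖^2 ∂μ) / 2 := by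
    have := mul_le_mul_of_nonneg_left L1 (inv_pos.2 hv).le
    rwa [mul_add, inv_mul_cancel_left₀ hv.ne'] at this
  have M2 : v⁻¹ * potB d 0 = v⁻¹ * ∫ x, potB d x ∂(uniformBall d 0) + (∫ x, ‖x‖^2 ∂(uniformBall d 0)) / 2 := by
    have := congrArg (fun z => v⁻¹ * z) L2
    rwa [mul_add, inv_mul_cancel_left₀ hv.ne'] at this
  rw [← b3] at M1
  rw [← c3] at M2
  refine ⟨by linarith, fun hle => p2 (le_antisymm (by linarith) p1)⟩


/-- for `d ≥ 2` and the quadratic confinement `V(x) = |x|²`, the electrostatic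
energy has a unique minimizer over the probability measures on `ℝ^d`, namely the uniform
probability measure on the closed unit ball. -/
theorem stmt0 (d : ℕ) (hd : 2 ≤ d) (V : Euc d → ℝ) (hV : ∀ x, V x = ‖x‖ ^ 2) :
    IsProbabilityMeasure (uniformBall d 0) ∧
    (∀ μ : Measure (Euc d), IsProbabilityMeasure μ →
      energy d V (uniformBall d 0) ≤ energy d V μ) ∧
    (∀ μ : Measure (Euc d), IsProbabilityMeasure μ →
      (∀ ν : Measure (Euc d), IsProbabilityMeasure ν → energy d V μ ≤ energy d V ν) →
      μ = uniformBall d 0) := by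
  obtain rfl : V = fun x => ‖x‖ ^ 2 := funext hV
  obtain ⟨e₀, h0, hm⟩ := energy_main d hd
  refine ⟨ub_prob d hd, fun μ hμ => ?_, fun μ hμ h => ?_⟩
  · by_cases ht : energy d (fun x => ‖x‖ ^ 2) μ = ⊤
    · rw [ht]; exact le_top
    · obtain ⟨e, h1, h2, -⟩ := hm μ hμ ht
      rw [h0, h1]
      exact EReal.coe_le_coe_iff.2 h2
  · have h1 := h _ (ub_prob d hd)
    have ht : energy d (fun x => ‖x‖ ^ 2) μ ≠ ⊤ := by
      intro ht
      rw [ht, h0] at h1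
      exact EReal.coe_ne_top _ (top_le_iff.1 h1)
    obtain ⟨e, h3, -, h4⟩ := hm μ hμ ht
    rw [h0, h3] at h1
    exact h4 (EReal.coe_le_coe_iff.1 h1)

end
end

section
/- Let d ≥ 2 and let V : ℝ^d → ℝ be lower semicontinuous satisfying the growth condition V(x) ≥ a|x|^q − R for some a > 0, R ∈ ℝ, q > 1, and let p ∈ (1, q). Then the domain D_E = {μ ∈ P(ℝ^d) : E(μ) < +∞} of the electrostatic energy E is convex, E is convex on D_E, and D_E ⊂ P_p(ℝ^d) (every measure of finite energy has finite p-th moment). -/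
open MeasureTheory Filter Metric
open scoped ENNReal NNReal RealInnerProductSpace BigOperators Topology ProbabilityTheory Classical

noncomputable section

lemma kernel_prod {E W : Type*} [MeasurableSpace E] [MeasurableSpace W] (l : Measure W) [SFinite l]
    (φ : E → W → ℝ≥0∞) (hφ : Measurable (Function.uncurry φ)) (μ ν : Measure E) [SFinite μ] [SFinite ν] :
    ∫⁻ p, (∫⁻ w, φ p.1 w * φ p.2 w ∂l) ∂(μ.prod ν)
      = ∫⁻ w, (∫⁻ x, φ x w ∂μ) * (∫⁻ y, φ y w ∂ν) ∂l := by
  rw [lintegral_lintegral_swap]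
  · refine lintegral_congr fun w => ?_
    rw [lintegral_prod_mul (f := fun x => φ x w) (g := fun x => φ x w)]
    · exact (hφ.comp (measurable_id.prodMk measurable_const)).aemeasurable
    · exact (hφ.comp (measurable_id.prodMk measurable_const)).aemeasurable
  · apply Measurable.aemeasurable
    apply Measurable.mul
    · exact hφ.comp ((measurable_fst.comp measurable_fst).prodMk measurable_snd)
    · exact hφ.comp ((measurable_snd.comp measurable_fst).prodMk measurable_snd)

lemma enn_two_mul (a b : ℝ≥0∞) : a * b + b * a ≤ a * a + b * b := by
  rcases le_total a b with h | h
  · obtain ⟨c, rfl⟩ := exists_add_of_le h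
    calc a * (a + c) + (a + c) * a = a * a + a * a + 2 * (a * c) := by ring
      _ ≤ a * a + a * a + 2 * (a * c) + c * c := le_self_add
      _ = _ := by ring
  · obtain ⟨c, rfl⟩ := exists_add_of_le h
    calc (b + c) * b + b * (b + c) = b * b + b * b + 2 * (b * c) := by ring
      _ ≤ b * b + b * b + 2 * (b * c) + c * c := le_self_add
      _ = _ := by ring

/-- positive-definiteness inequality for a kernel, tested on `μ - ν` -/
def PDk {E : Type*} [MeasurableSpace E] (μ ν : Measure E) (k : E × E → ℝ≥0∞) : Prop :=
  ∫⁻ p, k p ∂(μ.prod ν) + ∫⁻ p, k p ∂(ν.prod μ) ≤ ∫⁻ p, k p ∂(μ.prod μ) + ∫⁻ p, k p ∂(ν.prod ν)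

lemma kernel_pd {E W : Type*} [MeasurableSpace E] [MeasurableSpace W] (l : Measure W) [SFinite l]
    (φ : E → W → ℝ≥0∞) (hφ : Measurable (Function.uncurry φ)) (μ ν : Measure E) [SFinite μ] [SFinite ν] :
    PDk μ ν (fun p => ∫⁻ w, φ p.1 w * φ p.2 w ∂l) := by
  unfold PDk
  simp only [kernel_prod l φ hφ]
  have m : ∀ (ρ : Measure E) [SFinite ρ], Measurable fun w => ∫⁻ x, φ x w ∂ρ := fun ρ _ =>
    Measurable.lintegral_prod_left hφ
  rw [← lintegral_add_left (by exact (m μ).mul (m ν)), ← lintegral_add_left (by exact (m μ).mul (m μ))]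
  exact lintegral_mono fun w => enn_two_mul _ _

lemma PDk_of_const_mul {E : Type*} [MeasurableSpace E] {μ ν : Measure E} {k : E × E → ℝ≥0∞} {c : ℝ≥0∞}
    (hc0 : c ≠ 0) (hc : c ≠ ⊤) (h : PDk μ ν (fun p => c * k p)) : PDk μ ν k := by
  unfold PDk at *
  simp only [lintegral_const_mul' c _ hc, ← mul_add] at h
  exact (ENNReal.mul_le_mul_iff_right hc0 hc).1 h

lemma PDk_lintegral {E W : Type*} [MeasurableSpace E] [MeasurableSpace W] (l : Measure W) [SFinite l]
    {μ ν : Measure E} [SFinite μ] [SFinite ν]  (k : E × E → W → ℝ≥0∞) (hk : Measurable (Function.uncurry k))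
    (h : ∀ᵐ w ∂l, PDk μ ν (fun p => k p w)) : PDk μ ν (fun p => ∫⁻ w, k p w ∂l) := by
  unfold PDk at *
  have m : ∀ (ρ : Measure (E × E)) [SFinite ρ], Measurable fun w => ∫⁻ x, k x w ∂ρ := fun ρ _ =>
    Measurable.lintegral_prod_left hk
  rw [lintegral_lintegral_swap hk.aemeasurable, lintegral_lintegral_swap hk.aemeasurable,
    lintegral_lintegral_swap hk.aemeasurable, lintegral_lintegral_swap hk.aemeasurable,
    ← lintegral_add_left (m _), ← lintegral_add_left (m _)]
  exact lintegral_mono_ae h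

lemma gauss_pd {d : ℕ} (s : ℝ) (hs : 0 < s) (μ ν : Measure (Euc d)) [SFinite μ] [SFinite ν] :
    PDk μ ν (fun p => ENNReal.ofReal (Real.exp (-s * ‖p.1 - p.2‖ ^ 2))) := by
  set c : ℝ≥0∞ := ∫⁻ z : Euc d, ENNReal.ofReal (Real.exp (-(4 * s) * ‖z‖ ^ 2)) with hc
  have hint : Integrable (fun z : Euc d => Real.exp (-(4 * s) * ‖z‖ ^ 2)) := by
    have := (GaussianFourier.integrable_cexp_neg_mul_sq_norm_add (V := Euc d) (b := ((4 * s : ℝ) : ℂ))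
      (by simpa using hs) 0 0).re
    refine this.congr (ae_of_all _ fun z => ?_)
    simp only [zero_mul, add_zero]
    have : (-((4 * s : ℝ) : ℂ) * (‖z‖ : ℂ) ^ 2) = ((-(4 * s) * ‖z‖ ^ 2 : ℝ) : ℂ) := by push_cast; ring
    rw [this, ← Complex.ofReal_exp]; rfl
  have hctop : c ≠ ⊤ := hint.lintegral_lt_top.ne
  have hc0 : c ≠ 0 := by
    rw [hc, Ne, lintegral_eq_zero_iff (by fun_prop)]
    intro h
    have : ∀ᵐ z : Euc d, False := by
      filter_upwards [h] with z hz
      simp at hz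
      exact absurd hz (not_le.2 (Real.exp_pos _))
    simp at this
    exact NeZero.ne _ this
  refine PDk_of_const_mul hc0 hctop ?_
  have := kernel_pd (volume : Measure (Euc d))
    (fun x z => ENNReal.ofReal (Real.exp (-(2 * s) * ‖x - z‖ ^ 2))) (by unfold Function.uncurry; fun_prop) μ ν
  convert this using 2 with p
  rw [hc, ← lintegral_sub_right_eq_self _ ((1 / 2 : ℝ) • (p.1 + p.2)), ← lintegral_mul_const']
  · refine lintegral_congr fun z => ?_
    rw [← ENNReal.ofReal_mul (Real.exp_pos _).le, ← ENNReal.ofReal_mul (Real.exp_pos _).le, ← Real.exp_add, ← Real.exp_add]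
    congr 2
    have e : p.1 - p.2 = (p.1 - z) - (p.2 - z) := by abel
    have e2 : z - (1 / 2 : ℝ) • (p.1 + p.2) = -((1 / 2 : ℝ) • ((p.1 - z) + (p.2 - z))) := by module
    rw [e, e2, norm_neg, norm_smul, mul_pow, @norm_sub_sq_real, @norm_add_sq_real]
    norm_num
    ring
  · exact ENNReal.ofReal_ne_top

lemma riesz_pd {d : ℕ} (α ε : ℝ) (hα : 0 < α) (hε : 0 < ε) (μ ν : Measure (Euc d)) [SFinite μ] [SFinite ν] :
    PDk μ ν (fun p => ENNReal.ofReal ((‖p.1 - p.2‖ ^ 2 + ε) ^ (-α))) := by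
  have key : ∀ b : ℝ, 0 < b → ENNReal.ofReal (Real.Gamma α) * ENNReal.ofReal (b ^ (-α))
      = ∫⁻ s in Set.Ioi (0:ℝ), ENNReal.ofReal (s ^ (α - 1) * Real.exp (-(b * s))) := by
    intro b hb
    rw [← ofReal_integral_eq_lintegral_ofReal, Real.integral_rpow_mul_exp_neg_mul_Ioi hα hb,
      ← ENNReal.ofReal_mul (Real.Gamma_pos_of_pos hα).le]
    · rw [one_div, Real.inv_rpow hb.le, Real.rpow_neg hb.le, mul_comm]
    · have := integrableOn_rpow_mul_exp_neg_mul_rpow (p := 1) (s := α - 1) (by linarith) one_pos hb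
      simpa [IntegrableOn] using this
    · filter_upwards [ae_restrict_mem measurableSet_Ioi] with s hs
      have : (0:ℝ) < s := hs
      positivity
  refine PDk_of_const_mul (c := ENNReal.ofReal (Real.Gamma α)) (by simpa using Real.Gamma_pos_of_pos hα) ENNReal.ofReal_ne_top ?_
  have e : (fun p : Euc d × Euc d => ENNReal.ofReal (Real.Gamma α) * ENNReal.ofReal ((‖p.1 - p.2‖ ^ 2 + ε) ^ (-α)))
    = fun p => ∫⁻ s in Set.Ioi (0:ℝ), ENNReal.ofReal (s ^ (α - 1) * Real.exp (-((‖p.1 - p.2‖ ^ 2 + ε) * s))) := by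
    funext p
    exact key _ (by positivity)
  rw [e]
  apply PDk_lintegral
  · unfold Function.uncurry
    fun_prop
  · filter_upwards [ae_restrict_mem measurableSet_Ioi] with s hs
    have hs : (0:ℝ) < s := hs
    have := gauss_pd s hs μ ν
    have hc : 0 < s ^ (α - 1) * Real.exp (-(ε * s)) := by positivity
    refine PDk_of_const_mul (c := (ENNReal.ofReal (s ^ (α - 1) * Real.exp (-(ε * s))))⁻¹) (by simp) (by simpa using hc) ?_
    convert this using 2 with p
    have : s ^ (α - 1) * Real.exp (-((‖p.1 - p.2‖ ^ 2 + ε) * s)) = (s ^ (α - 1) * Real.exp (-(ε * s))) * Real.exp (-s * ‖p.1 - p.2‖ ^ 2) := by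
      rw [mul_assoc, ← Real.exp_add]; ring_nf
    rw [this, ENNReal.ofReal_mul hc.le, ← mul_assoc, ENNReal.inv_mul_cancel (by simpa using hc) ENNReal.ofReal_ne_top, one_mul]

/-- real-valued version of `PDk` -/
def PDr {E : Type*} [MeasurableSpace E] (μ ν : Measure E) (k : E × E → ℝ) : Prop :=
  ∫ p, k p ∂(μ.prod ν) + ∫ p, k p ∂(ν.prod μ) ≤ ∫ p, k p ∂(μ.prod μ) + ∫ p, k p ∂(ν.prod ν)

/-- integrability against the four products -/
def Int4 {E : Type*} [MeasurableSpace E] (μ ν : Measure E) (k : E × E → ℝ) : Prop :=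
  Integrable k (μ.prod ν) ∧ Integrable k (ν.prod μ) ∧ Integrable k (μ.prod μ) ∧ Integrable k (ν.prod ν)

lemma PDr_of_PDk {E : Type*} [MeasurableSpace E] {μ ν : Measure E} {k : E × E → ℝ}
    (hi : Int4 μ ν k) (h0 : ∀ p, 0 ≤ k p) (h : PDk μ ν (fun p => ENNReal.ofReal (k p))) : PDr μ ν k := by
  obtain ⟨h1, h2, h3, h4⟩ := hi
  unfold PDk at h
  unfold PDr
  rw [← ofReal_integral_eq_lintegral_ofReal h1 (ae_of_all _ h0), ← ofReal_integral_eq_lintegral_ofReal h2 (ae_of_all _ h0),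
    ← ofReal_integral_eq_lintegral_ofReal h3 (ae_of_all _ h0), ← ofReal_integral_eq_lintegral_ofReal h4 (ae_of_all _ h0),
    ← ENNReal.ofReal_add (integral_nonneg h0) (integral_nonneg h0),
    ← ENNReal.ofReal_add (integral_nonneg h0) (integral_nonneg h0)] at h
  exact (ENNReal.ofReal_le_ofReal_iff (add_nonneg (integral_nonneg h0) (integral_nonneg h0))).1 h

lemma PDk_of_PDr {E : Type*} [MeasurableSpace E] {μ ν : Measure E} {k : E × E → ℝ}
    (hi : Int4 μ ν k) (h0 : ∀ p, 0 ≤ k p) (h : PDr μ ν k) : PDk μ ν (fun p => ENNReal.ofReal (k p)) := by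
  obtain ⟨h1, h2, h3, h4⟩ := hi
  unfold PDr at h
  unfold PDk
  rw [← ofReal_integral_eq_lintegral_ofReal h1 (ae_of_all _ h0), ← ofReal_integral_eq_lintegral_ofReal h2 (ae_of_all _ h0),
    ← ofReal_integral_eq_lintegral_ofReal h3 (ae_of_all _ h0), ← ofReal_integral_eq_lintegral_ofReal h4 (ae_of_all _ h0),
    ← ENNReal.ofReal_add (integral_nonneg h0) (integral_nonneg h0),
    ← ENNReal.ofReal_add (integral_nonneg h0) (integral_nonneg h0)]
  exact ENNReal.ofReal_le_ofReal h

lemma PDr_affine {E : Type*} [MeasurableSpace E] {μ ν : Measure E} [IsProbabilityMeasure μ] [IsProbabilityMeasure ν]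
    {k : E × E → ℝ} (hi : Int4 μ ν k) (h : PDr μ ν k) (c b : ℝ) (hc : 0 ≤ c) : PDr μ ν (fun p => c * k p + b) := by
  obtain ⟨h1, h2, h3, h4⟩ := hi
  unfold PDr at *
  rw [integral_add (h1.const_mul c) (integrable_const b), integral_add (h2.const_mul c) (integrable_const b),
    integral_add (h3.const_mul c) (integrable_const b), integral_add (h4.const_mul c) (integrable_const b)]
  simp only [integral_const_mul, integral_const, probReal_univ, one_smul]
  nlinarith

/-- adding a potential term does not change the inequality -/
lemma PDr_add_pot {E : Type*} [MeasurableSpace E] {μ ν : Measure E} [IsProbabilityMeasure μ] [IsProbabilityMeasure ν]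
    {k : E × E → ℝ} (hi : Int4 μ ν k) (h : PDr μ ν k) (W : E → ℝ) (hμ : Integrable W μ) (hν : Integrable W ν) :
    Int4 μ ν (fun p => k p + (W p.1 + W p.2)) ∧ PDr μ ν (fun p => k p + (W p.1 + W p.2)) := by
  obtain ⟨h1, h2, h3, h4⟩ := hi
  have I : ∀ (a b : Measure E) [IsProbabilityMeasure a] [IsProbabilityMeasure b], Integrable W a → Integrable W b →
      Integrable (fun p : E × E => W p.1 + W p.2) (a.prod b) ∧ ∫ p, (W p.1 + W p.2) ∂(a.prod b) = ∫ x, W x ∂a + ∫ x, W x ∂b := by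
    intro a b _ _ ha hb
    refine ⟨(ha.comp_fst b).add (hb.comp_snd a), ?_⟩
    rw [integral_add (ha.comp_fst b) (hb.comp_snd a), integral_fun_fst, integral_fun_snd]
    simp
  obtain ⟨i1, e1⟩ := I μ ν hμ hν
  obtain ⟨i2, e2⟩ := I ν μ hν hμ
  obtain ⟨i3, e3⟩ := I μ μ hμ hμ
  obtain ⟨i4, e4⟩ := I ν ν hν hν
  refine ⟨⟨h1.add i1, h2.add i2, h3.add i3, h4.add i4⟩, ?_⟩
  unfold PDr at *
  rw [integral_add h1 i1, integral_add h2 i2, integral_add h3 i3, integral_add h4 i4, e1, e2, e3, e4]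
  linarith

/-- regularised Coulomb kernel -/
def gE (d : ℕ) (ε : ℝ) (x : Euc d) : ℝ :=
  if d = 2 then -(1 / 2) * Real.log (‖x‖ ^ 2 + ε)
  else 1 / ((d : ℝ) - 2) * (‖x‖ ^ 2 + ε) ^ (-(((d : ℝ) - 2) / 2))

lemma gE_measurable (d : ℕ) (ε : ℝ) : Measurable (gE d ε) := by
  unfold gE
  split_ifs <;> fun_prop

lemma dsub_pos {d : ℕ} (hd : 2 ≤ d) (h : d ≠ 2) : (0 : ℝ) < (d : ℝ) - 2 := by
  have : 3 ≤ d := by omega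
  have : (3 : ℝ) ≤ d := by exact_mod_cast this
  linarith

lemma gE_lower {d : ℕ} (hd : 2 ≤ d) {ε : ℝ} (h0 : 0 < ε) (h1 : ε ≤ 1) (x : Euc d) : -‖x‖ ≤ gE d ε x := by
  unfold gE
  have hx := norm_nonneg x
  split_ifs with h
  · have : Real.log (‖x‖ ^ 2 + ε) ≤ 2 * ‖x‖ := by
      calc Real.log (‖x‖ ^ 2 + ε) ≤ Real.log ((‖x‖ + 1) ^ 2) := Real.log_le_log (by positivity) (by nlinarith)
        _ = 2 * Real.log (‖x‖ + 1) := by rw [Real.log_pow]; norm_num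
        _ ≤ 2 * ‖x‖ := by
          have := Real.log_le_sub_one_of_pos (x := ‖x‖ + 1) (by positivity)
          linarith
    linarith
  · have := dsub_pos hd h
    have : 0 ≤ 1 / ((d : ℝ) - 2) * (‖x‖ ^ 2 + ε) ^ (-(((d : ℝ) - 2) / 2)) := by positivity
    linarith

lemma gE_anti {d : ℕ} (hd : 2 ≤ d) {ε δ : ℝ} (hle : ε ≤ δ) (x : Euc d) (h0 : 0 < ‖x‖ ^ 2 + ε) : gE d δ x ≤ gE d ε x := by
  unfold gE
  split_ifs with h
  · have := Real.log_le_log h0 (show ‖x‖ ^ 2 + ε ≤ ‖x‖ ^ 2 + δ by linarith)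
    linarith
  · have := dsub_pos hd h
    gcongr ?_ * ?_
    exact Real.rpow_le_rpow_of_nonpos h0 (by linarith) (by linarith)

lemma gE_upper {d : ℕ} (hd : 2 ≤ d) {ε : ℝ} (h0 : 0 < ε) (x : Euc d) : gE d ε x ≤ gE d ε 0 := by
  have h1 : gE d ε x = gE d (‖x‖ ^ 2 + ε) 0 := by simp [gE]
  rw [h1]
  exact gE_anti hd (by nlinarith [norm_nonneg x]) 0 (by simpa using h0)

lemma gE_zero {d : ℕ} (hd : 2 ≤ d) {x : Euc d} (hx : x ≠ 0) : gE d 0 x =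
    if d = 2 then Real.log (1 / ‖x‖) else 1 / (((d : ℝ) - 2) * ‖x‖ ^ ((d : ℕ) - 2)) := by
  have hx := norm_pos_iff.2 hx
  unfold gE
  split_ifs with h
  · rw [add_zero, Real.log_pow, one_div ‖x‖, Real.log_inv]; push_cast; ring
  · rw [add_zero, ← Real.rpow_natCast, ← Real.rpow_mul hx.le, one_div, one_div, mul_inv]
    congr 1
    rw [← Real.rpow_natCast, ← Real.rpow_neg hx.le]
    congr 1
    push_cast [Nat.cast_sub hd]
    ring

lemma gE_tendsto {d : ℕ} {x : Euc d} (hx : x ≠ 0) : Tendsto (fun ε => gE d ε x) (𝓝 0) (𝓝 (gE d 0 x)) := by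
  have hx := norm_pos_iff.2 hx
  have : ContinuousAt (fun ε => gE d ε x) 0 := by
    unfold gE
    split_ifs with h
    · refine continuousAt_const.mul (ContinuousAt.log (by fun_prop) (by positivity))
    · refine continuousAt_const.mul (ContinuousAt.rpow_const (by fun_prop) (Or.inl (by positivity)))
  exact this

lemma gE_tendsto_zero {d : ℕ} (hd : 2 ≤ d) : Tendsto (fun ε => gE d ε (0 : Euc d)) (𝓝[>] 0) atTop := by
  unfold gE
  split_ifs with h
  · simp only [norm_zero, ne_eq, OfNat.ofNat_ne_zero, not_false_eq_true, zero_pow, zero_add]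
    exact Real.tendsto_log_nhdsGT_zero.const_mul_atBot_of_neg (by norm_num)
  · have := dsub_pos hd h
    simp only [norm_zero, ne_eq, OfNat.ofNat_ne_zero, not_false_eq_true, zero_pow, zero_add]
    exact (tendsto_rpow_neg_nhdsGT_zero (by linarith)).const_mul_atTop (by positivity)

lemma int4_of_bound {d : ℕ} {μ ν : Measure (Euc d)} [IsProbabilityMeasure μ] [IsProbabilityMeasure ν]
    (hμ : Integrable (fun x => ‖x‖) μ) (hν : Integrable (fun x => ‖x‖) ν) {k : Euc d × Euc d → ℝ} (hk : Measurable k)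
    (B : ℝ) (hB : ∀ p, |k p| ≤ ‖p.1‖ + ‖p.2‖ + B) : Int4 μ ν k := by
  have I : ∀ (a b : Measure (Euc d)) [IsProbabilityMeasure a] [IsProbabilityMeasure b], Integrable (fun x => ‖x‖) a →
      Integrable (fun x => ‖x‖) b → Integrable k (a.prod b) := by
    intro a b _ _ ha hb
    exact (((ha.comp_fst b).add (hb.comp_snd a)).add (integrable_const B)).mono' hk.aestronglyMeasurable (ae_of_all _ hB)
  exact ⟨I _ _ hμ hν, I _ _ hν hμ, I _ _ hμ hμ, I _ _ hν hν⟩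

lemma gE_int4 {d : ℕ} (hd : 2 ≤ d) {ε : ℝ} (h0 : 0 < ε) (h1 : ε ≤ 1) {μ ν : Measure (Euc d)} [IsProbabilityMeasure μ] [IsProbabilityMeasure ν]
    (hμ : Integrable (fun x => ‖x‖) μ) (hν : Integrable (fun x => ‖x‖) ν) :
    Int4 μ ν (fun p => gE d ε (p.1 - p.2)) := by
  refine int4_of_bound hμ hν ((gE_measurable d ε).comp (measurable_fst.sub measurable_snd)) |gE d ε 0| fun p => ?_
  have a := gE_lower hd h0 h1 (p.1 - p.2)
  have b := gE_upper hd h0 (p.1 - p.2)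
  have c := norm_sub_le p.1 p.2
  have e := le_abs_self (gE d ε 0)
  have e' := abs_nonneg (gE d ε 0)
  have := norm_nonneg p.1
  have := norm_nonneg p.2
  rw [abs_le]
  constructor <;> linarith

lemma riesz_pdr {d : ℕ} (α ε : ℝ) (hα : 0 < α) (hε : 0 < ε) {μ ν : Measure (Euc d)} [IsProbabilityMeasure μ] [IsProbabilityMeasure ν] 
    (hμ : Integrable (fun x => ‖x‖) μ) (hν : Integrable (fun x => ‖x‖) ν) (c b : ℝ) (hc : 0 ≤ c) :
    PDr μ ν (fun p => c * (‖p.1 - p.2‖ ^ 2 + ε) ^ (-α) + b) := by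
  have hi : Int4 μ ν (fun p => (‖p.1 - p.2‖ ^ 2 + ε) ^ (-α)) := by
    refine int4_of_bound hμ hν (by fun_prop) (ε ^ (-α)) fun p => ?_
    have := Real.rpow_le_rpow_of_nonpos hε (show ε ≤ ‖p.1 - p.2‖ ^ 2 + ε by nlinarith [norm_nonneg (p.1 - p.2)]) (show -α ≤ 0 by linarith)
    rw [abs_of_nonneg (by positivity)]
    have := norm_nonneg p.1
    have := norm_nonneg p.2
    linarith
  exact PDr_affine hi (PDr_of_PDk hi (fun p => by positivity) (riesz_pd α ε hα hε μ ν)) c b hc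

lemma log_approx_bound {b α : ℝ} (hb : 0 < b) (h0 : 0 < α) (h1 : α ≤ 1) :
    -Real.log b ≤ (b ^ (-α) - 1) / α ∧ (b ^ (-α) - 1) / α ≤ b⁻¹ := by
  constructor
  · rw [le_div_iff₀ h0, Real.rpow_def_of_pos hb]
    have := Real.add_one_le_exp (Real.log b * -α)
    linarith
  · rw [div_le_iff₀ h0, Real.rpow_neg hb.le, ← Real.inv_rpow hb.le]
    have hb' : 0 < b⁻¹ := by positivity
    have := rpow_one_add_le_one_add_mul_self (s := b⁻¹ - 1) (by linarith) h0.le h1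
    rw [add_sub_cancel] at this
    nlinarith

lemma log_approx_tendsto {b : ℝ} (hb : 0 < b) :
    Tendsto (fun n : ℕ => (b ^ (-(1 / ((n : ℝ) + 1))) - 1) / (1 / ((n : ℝ) + 1))) atTop (𝓝 (-Real.log b)) := by
  have h : HasDerivAt (fun α : ℝ => b ^ (-α)) (-Real.log b) 0 := by
    have := (hasDerivAt_neg (0 : ℝ)).const_rpow hb
    simpa using this
  rw [hasDerivAt_iff_tendsto_slope_zero] at h
  have t : Tendsto (fun n : ℕ => 1 / ((n : ℝ) + 1)) atTop (𝓝[≠] 0) := by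
    refine tendsto_nhdsWithin_iff.2 ⟨tendsto_one_div_add_atTop_nhds_zero_nat, Eventually.of_forall fun n => ?_⟩
    have : (0 : ℝ) < 1 / ((n : ℝ) + 1) := by positivity
    exact this.ne'
  refine (h.comp t).congr fun n => ?_
  simp only [Function.comp, zero_add, neg_zero, Real.rpow_zero, smul_eq_mul]
  exact (div_eq_inv_mul _ _).symm

lemma gE_pdr {d : ℕ} (hd : 2 ≤ d) {ε : ℝ} (h0 : 0 < ε) (h1 : ε ≤ 1) {μ ν : Measure (Euc d)} [IsProbabilityMeasure μ] [IsProbabilityMeasure ν]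
    (hμ : Integrable (fun x => ‖x‖) μ) (hν : Integrable (fun x => ‖x‖) ν) :
    PDr μ ν (fun p => gE d ε (p.1 - p.2)) := by
  by_cases h : d = 2
  · set f : ℕ → Euc d × Euc d → ℝ := fun n p => (1 / 2) * (((‖p.1 - p.2‖ ^ 2 + ε) ^ (-(1 / ((n : ℝ) + 1))) - 1) / (1 / ((n : ℝ) + 1))) with hf
    have hpd : ∀ n, PDr μ ν (f n) := by
      intro n
      have hn : (0 : ℝ) < 1 / ((n : ℝ) + 1) := by positivity
      have := riesz_pdr (1 / ((n : ℝ) + 1)) ε hn h0 hμ hν (1 / 2 * (1 / (1 / ((n : ℝ) + 1)))) (-(1 / 2 * (1 / (1 / ((n : ℝ) + 1))))) (by positivity)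
      convert this using 2 with p
      ring
    have hg := gE_int4 hd h0 h1 hμ hν
    have T : ∀ (a b : Measure (Euc d)) [IsProbabilityMeasure a] [IsProbabilityMeasure b], Integrable (fun p : Euc d × Euc d => gE d ε (p.1 - p.2)) (a.prod b) →
        Tendsto (fun n => ∫ p, f n p ∂(a.prod b)) atTop (𝓝 (∫ p, gE d ε (p.1 - p.2) ∂(a.prod b))) := by
      intro a b _ _ hi
      refine tendsto_integral_of_dominated_convergence (fun p => |gE d ε (p.1 - p.2)| + ε⁻¹) ?_ (hi.abs.add (integrable_const _)) ?_ ?_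
      · intro n
        exact Measurable.aestronglyMeasurable (by fun_prop)
      · intro n
        refine ae_of_all _ fun p => ?_
        have hb : 0 < ‖p.1 - p.2‖ ^ 2 + ε := by positivity
        have hn : 1 / ((n : ℝ) + 1) ≤ 1 := by
          rw [div_le_one (by positivity)]; linarith [(Nat.cast_nonneg n : (0 : ℝ) ≤ n)]
        obtain ⟨l, u⟩ := log_approx_bound hb (α := 1 / ((n : ℝ) + 1)) (by positivity) hn
        have e : gE d ε (p.1 - p.2) = 1 / 2 * (- Real.log (‖p.1 - p.2‖ ^ 2 + ε)) := by
          unfold gE; rw [if_pos h]; ring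
        have hinv : (‖p.1 - p.2‖ ^ 2 + ε)⁻¹ ≤ ε⁻¹ := by
          apply inv_anti₀ h0; nlinarith [norm_nonneg (p.1 - p.2)]
        have := neg_abs_le (gE d ε (p.1 - p.2))
        have := abs_nonneg (gE d ε (p.1 - p.2))
        have : 0 < ε⁻¹ := by positivity
        rw [Real.norm_eq_abs, abs_le]
        simp only [hf]
        constructor <;> linarith
      · refine ae_of_all _ fun p => ?_
        have e : gE d ε (p.1 - p.2) = 1 / 2 * (- Real.log (‖p.1 - p.2‖ ^ 2 + ε)) := by
          unfold gE; rw [if_pos h]; ring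
        rw [e]
        exact (log_approx_tendsto (by positivity)).const_mul _
    obtain ⟨i1, i2, i3, i4⟩ := hg
    exact le_of_tendsto_of_tendsto' ((T μ ν i1).add (T ν μ i2)) ((T μ μ i3).add (T ν ν i4)) hpd
  · have hd' := dsub_pos hd h
    have := riesz_pdr (((d : ℝ) - 2) / 2) ε (by linarith) h0 hμ hν (1 / ((d : ℝ) - 2)) 0 (by positivity)
    simpa [gE, h] using this

lemma growth_aux {a q p : ℝ} (ha : 0 < a) (hp1 : 1 < p) (hpq : p < q) (R : ℝ) :
    ∃ C : ℝ, 0 ≤ C ∧ ∀ r : ℝ, 0 ≤ r → 2 * (r ^ p + r) ≤ (a * r ^ q - R) / 2 + C := by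
  set M : ℝ := max 1 ((8 / a) ^ (1 / (q - p))) with hM
  have hM1 : 1 ≤ M := le_max_left _ _
  refine ⟨4 * M ^ p + |R| / 2, by positivity, fun r hr => ?_⟩
  have hR := le_abs_self R
  rcases le_total r M with h | h
  · have e1 : r ^ p ≤ M ^ p := Real.rpow_le_rpow hr h (by linarith)
    have e2 : r ≤ M ^ p := h.trans (by simpa using Real.rpow_le_rpow_of_exponent_le hM1 hp1.le)
    have : 0 ≤ a * r ^ q := by positivity
    linarith
  · have hr1 : 1 ≤ r := hM1.trans h
    have hr0 : 0 < r := by linarith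
    have e1 : r ≤ r ^ p := by simpa using Real.rpow_le_rpow_of_exponent_le hr1 hp1.le
    have e2 : 8 / a ≤ r ^ (q - p) := by
      have h2 : (8 / a) ^ (1 / (q - p)) ≤ r := (le_max_right _ _).trans h
      have := Real.rpow_le_rpow (by positivity) h2 (show 0 ≤ q - p by linarith)
      rwa [← Real.rpow_mul (by positivity), one_div_mul_cancel (by linarith), Real.rpow_one] at this
    have e3 : r ^ q = r ^ (q - p) * r ^ p := by rw [← Real.rpow_add hr0]; ring_nf
    have e4 : 8 ≤ a * r ^ (q - p) := by
      rw [div_le_iff₀ ha] at e2; linarith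
    have hp0 : 0 < r ^ p := by positivity
    have hMp : 0 < M ^ p := by positivity
    have e5 : 8 * r ^ p ≤ a * r ^ q := by
      rw [e3, ← mul_assoc]; exact mul_le_mul_of_nonneg_right e4 hp0.le
    linarith

/-- regularised full interaction -/
def kE (d : ℕ) (V : Euc d → ℝ) (ε : ℝ) (p : Euc d × Euc d) : ℝ :=
  gE d ε (p.1 - p.2) + (V p.1 + V p.2) / 2

/-- the shifted integrand -/
def Fk (d : ℕ) (V : Euc d → ℝ) (C : ℝ) (p : Euc d × Euc d) : ℝ≥0∞ :=
  if p.1 = p.2 then ⊤ else ENNReal.ofReal (kE d V 0 p + 2 * C)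

lemma integrand_eq {d : ℕ} (hd : 2 ≤ d) (V : Euc d → ℝ) (p : Euc d × Euc d) :
    (coulombK d (p.1 - p.2) + (((V p.1 + V p.2) / 2 : ℝ) : EReal)) = if p.1 = p.2 then ⊤ else ((kE d V 0 p : ℝ) : EReal) := by
  unfold coulombK kE
  by_cases h : p.1 = p.2
  · simp [h]
  · have h' : p.1 - p.2 ≠ 0 := sub_ne_zero.2 h
    rw [if_neg h', if_neg h, gE_zero hd h']
    split_ifs <;> rw [EReal.coe_add]

lemma posP_eq {d : ℕ} (hd : 2 ≤ d) (V : Euc d → ℝ) (p : Euc d × Euc d) :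
    posP (coulombK d (p.1 - p.2) + (((V p.1 + V p.2) / 2 : ℝ) : EReal)) = if p.1 = p.2 then ⊤ else ENNReal.ofReal (kE d V 0 p) := by
  rw [integrand_eq hd]
  split_ifs <;> simp [posP]

lemma negP_eq {d : ℕ} (hd : 2 ≤ d) (V : Euc d → ℝ) (p : Euc d × Euc d) :
    posP (-(coulombK d (p.1 - p.2) + (((V p.1 + V p.2) / 2 : ℝ) : EReal))) = if p.1 = p.2 then 0 else ENNReal.ofReal (-kE d V 0 p) := by
  rw [integrand_eq hd]
  split_ifs
  · simp [posP]
  · rw [← EReal.coe_neg]; simp [posP]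

lemma kE_measurable {d : ℕ} {V : Euc d → ℝ} (hV : Measurable V) (ε : ℝ) : Measurable (kE d V ε) := by
  unfold kE
  have := (gE_measurable d ε).comp (measurable_fst.sub measurable_snd : Measurable fun p : Euc d × Euc d => p.1 - p.2)
  simp only [Function.comp_def] at this
  fun_prop

lemma kE_lower {d : ℕ} (hd : 2 ≤ d) {V : Euc d → ℝ} {C : ℝ} (hC : ∀ x, 2 * ‖x‖ ≤ V x / 2 + C) {ε : ℝ} (h0 : 0 < ε) (h1 : ε ≤ 1)
    (p : Euc d × Euc d) : (V p.1 / 2 + C) / 2 ≤ kE d V ε p + 2 * C := by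
  have a := gE_lower hd h0 h1 (p.1 - p.2)
  have b := norm_sub_le p.1 p.2
  have c1 := hC p.1
  have c2 := hC p.2
  have := norm_nonneg p.1
  have := norm_nonneg p.2
  unfold kE
  linarith

lemma kE_le {d : ℕ} (hd : 2 ≤ d) {V : Euc d → ℝ} {ε : ℝ} (h0 : 0 < ε) {p : Euc d × Euc d} (hp : p.1 ≠ p.2) : 
    kE d V ε p ≤ kE d V 0 p := by
  have h' : 0 < ‖p.1 - p.2‖ := norm_pos_iff.2 (sub_ne_zero.2 hp)
  have := gE_anti hd h0.le (p.1 - p.2) (by positivity)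
  unfold kE
  linarith

lemma kE_le_Fk {d : ℕ} (hd : 2 ≤ d) {V : Euc d → ℝ} {ε C : ℝ} (h0 : 0 < ε) (p : Euc d × Euc d) : 
    ENNReal.ofReal (kE d V ε p + 2 * C) ≤ Fk d V C p := by
  unfold Fk
  split_ifs with h
  · exact le_top
  · exact ENNReal.ofReal_le_ofReal (by linarith [kE_le hd (V := V) h0 h])

lemma Fk_pd {d : ℕ} (hd : 2 ≤ d) {V : Euc d → ℝ} (hV : Measurable V) {C : ℝ} (hC : ∀ x, 2 * ‖x‖ ≤ V x / 2 + C)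
    {μ ν : Measure (Euc d)} [IsProbabilityMeasure μ] [IsProbabilityMeasure ν] (hμ : Integrable V μ) (hν : Integrable V ν) :
    PDk μ ν (Fk d V C) := by
  have N : ∀ (a : Measure (Euc d)) [IsProbabilityMeasure a], Integrable V a → Integrable (fun x => ‖x‖) a := by
    intro a _ ha
    refine ((ha.div_const 2).add (integrable_const C)).mono' (by fun_prop) (ae_of_all _ fun x => ?_)
    have := hC x
    have := norm_nonneg x
    simp only [norm_norm, Pi.add_apply]
    linarith
  set e : ℕ → ℝ := fun n => 1 / ((n : ℝ) + 1) with he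
  have e0 : ∀ n, 0 < e n := fun n => by simp only [he]; positivity
  have e1 : ∀ n, e n ≤ 1 := fun n => by
    simp only [he]; rw [div_le_one (by positivity)]; linarith [(Nat.cast_nonneg n : (0 : ℝ) ≤ n)]
  have te : Tendsto e atTop (𝓝[>] 0) :=
    tendsto_nhdsWithin_iff.2 ⟨tendsto_one_div_add_atTop_nhds_zero_nat, Eventually.of_forall e0⟩
  have hn : ∀ n, PDk μ ν (fun p => ENNReal.ofReal (kE d V (e n) p + 2 * C)) := by
    intro n
    obtain ⟨i, j⟩ := PDr_add_pot (gE_int4 hd (e0 n) (e1 n) (N μ hμ) (N ν hν)) (gE_pdr hd (e0 n) (e1 n) (N μ hμ) (N ν hν))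
      (fun x => V x / 2 + C) ((hμ.div_const 2).add (integrable_const C)) ((hν.div_const 2).add (integrable_const C))
    have ee : (fun p : Euc d × Euc d => gE d (e n) (p.1 - p.2) + ((V p.1 / 2 + C) + (V p.2 / 2 + C))) = fun p => kE d V (e n) p + 2 * C := by
      funext p; unfold kE; ring
    simp only [ee] at i j
    refine PDk_of_PDr i (fun p => ?_) j
    have := kE_lower hd hC (e0 n) (e1 n) p
    have := hC p.1
    have := norm_nonneg p.1
    linarith
  have lim : ∀ p, Fk d V C p ≤ liminf (fun n => ENNReal.ofReal (kE d V (e n) p + 2 * C)) atTop := by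
    intro p
    refine (Tendsto.liminf_eq ?_).ge
    unfold Fk
    split_ifs with h
    · refine ENNReal.tendsto_ofReal_nhds_top.2 ?_
      unfold kE
      rw [h, sub_self]
      exact tendsto_atTop_add_const_right _ _ (tendsto_atTop_add_const_right _ _ ((gE_tendsto_zero hd).comp te))
    · refine ENNReal.tendsto_ofReal ?_
      unfold kE
      exact (((gE_tendsto (sub_ne_zero.2 h)).comp (te.mono_right nhdsWithin_le_nhds)).add_const _).add_const _
  unfold PDk
  rw [← lintegral_add_measure]
  calc _ ≤ ∫⁻ p, liminf (fun n => ENNReal.ofReal (kE d V (e n) p + 2 * C)) atTop ∂(μ.prod ν + ν.prod μ) := lintegral_mono lim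
    _ ≤ liminf (fun n => ∫⁻ p, ENNReal.ofReal (kE d V (e n) p + 2 * C) ∂(μ.prod ν + ν.prod μ)) atTop :=
      lintegral_liminf_le fun n => ((kE_measurable hV _).add_const _).ennreal_ofReal
    _ ≤ liminf (fun _ : ℕ => ∫⁻ p, Fk d V C p ∂(μ.prod μ) + ∫⁻ p, Fk d V C p ∂(ν.prod ν)) atTop := by
      refine liminf_le_liminf (Eventually.of_forall fun n => ?_)
      rw [lintegral_add_measure]
      exact (hn n).trans (add_le_add (lintegral_mono fun p => kE_le_Fk hd (e0 n) p) (lintegral_mono fun p => kE_le_Fk hd (e0 n) p))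
    _ = _ := liminf_const _

lemma kE_zero_lower {d : ℕ} (hd : 2 ≤ d) {V : Euc d → ℝ} {C : ℝ} (hC : ∀ x, 2 * ‖x‖ ≤ V x / 2 + C)
    {p : Euc d × Euc d} (hp : p.1 ≠ p.2) : (V p.1 / 2 + C) / 2 ≤ kE d V 0 p + 2 * C :=
  (kE_lower hd hC one_pos le_rfl p).trans (by linarith [kE_le hd (V := V) one_pos hp])

lemma energy_rel {d : ℕ} (hd : 2 ≤ d) {V : Euc d → ℝ} (hV : Measurable V) {C : ℝ} (hC0 : 0 ≤ C) (hC : ∀ x, 2 * ‖x‖ ≤ V x / 2 + C)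
    (μ : Measure (Euc d)) [IsProbabilityMeasure μ] :
    (energy d V μ ≠ ⊤ → ∫⁻ p, Fk d V C p ∂(μ.prod μ) ≠ ⊤) ∧
    (∫⁻ p, Fk d V C p ∂(μ.prod μ) ≠ ⊤ → energy d V μ = (((∫⁻ p, Fk d V C p ∂(μ.prod μ)).toReal - 2 * C : ℝ) : EReal)) := by
  unfold energy
  simp only [posP_eq hd, negP_eq hd]
  set A := ∫⁻ p : Euc d × Euc d, (if p.1 = p.2 then ⊤ else ENNReal.ofReal (kE d V 0 p)) ∂(μ.prod μ) with hA
  set B := ∫⁻ p : Euc d × Euc d, (if p.1 = p.2 then 0 else ENNReal.ofReal (-kE d V 0 p)) ∂(μ.prod μ) with hB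
  set F := ∫⁻ p, Fk d V C p ∂(μ.prod μ) with hF
  have nn : ∀ p : Euc d × Euc d, p.1 ≠ p.2 → 0 ≤ kE d V 0 p + 2 * C := fun p hp => by
    have := kE_zero_lower hd hC hp
    have := hC p.1
    have := norm_nonneg p.1
    linarith
  have hBle : B ≤ ENNReal.ofReal (2 * C) := by
    calc B ≤ ∫⁻ p, ENNReal.ofReal (2 * C) ∂(μ.prod μ) := by
          refine lintegral_mono fun p => ?_
          dsimp only
          split_ifs with h
          · exact bot_le
          · exact ENNReal.ofReal_le_ofReal (by linarith [nn p h])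
      _ = _ := by simp
  have hBt : B ≠ ⊤ := (hBle.trans_lt ENNReal.ofReal_lt_top).ne
  have key : A + ENNReal.ofReal (2 * C) = F + B := by
    have hm : Measurable fun p : Euc d × Euc d => if p.1 = p.2 then (0 : ℝ≥0∞) else ENNReal.ofReal (-kE d V 0 p) :=
      Measurable.ite (measurableSet_eq_fun measurable_fst measurable_snd) measurable_const ((kE_measurable hV 0).neg.ennreal_ofReal)
    have : ENNReal.ofReal (2 * C) = ∫⁻ p, ENNReal.ofReal (2 * C) ∂(μ.prod μ) := by simp
    rw [this, hA, hF, hB, ← lintegral_add_right _ measurable_const, ← lintegral_add_right _ hm]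
    refine lintegral_congr fun p => ?_
    unfold Fk
    split_ifs with h
    · simp
    · have := nn p h
      rcases le_total 0 (kE d V 0 p) with h' | h'
      · rw [ENNReal.ofReal_of_nonpos (show -kE d V 0 p ≤ 0 by linarith), add_zero, ENNReal.ofReal_add h' (by linarith)]
      · rw [ENNReal.ofReal_of_nonpos h', zero_add, ← ENNReal.ofReal_add this (by linarith)]
        congr 1; ring
  constructor
  · intro h hFt
    apply h
    have : A = ⊤ := by
      by_contra hAt
      have : A + ENNReal.ofReal (2 * C) ≠ ⊤ := ENNReal.add_ne_top.2 ⟨hAt, ENNReal.ofReal_ne_top⟩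
      rw [key, hFt] at this
      simp at this
    rw [this]
    clear_value B
    lift B to ℝ≥0 using hBt
    rw [EReal.coe_ennreal_top]
    exact EReal.top_sub_coe _
  · intro hFt
    have hAt : A ≠ ⊤ := by
      intro h
      rw [h, top_add] at key
      exact ENNReal.add_ne_top.2 ⟨hFt, hBt⟩ key.symm
    have kr := congrArg ENNReal.toReal key
    rw [ENNReal.toReal_add hAt ENNReal.ofReal_ne_top, ENNReal.toReal_add hFt hBt, ENNReal.toReal_ofReal (by linarith)] at kr
    rw [← EReal.coe_ennreal_toReal hAt, ← EReal.coe_ennreal_toReal hBt, ← EReal.coe_sub]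
    congr 1
    linarith

lemma V_integrable {d : ℕ} (hd : 2 ≤ d) {V : Euc d → ℝ} (hV : Measurable V) {C : ℝ} (hC : ∀ x, 2 * ‖x‖ ≤ V x / 2 + C)
    (μ : Measure (Euc d)) [IsProbabilityMeasure μ] (h : ∫⁻ p, Fk d V C p ∂(μ.prod μ) ≠ ⊤) : Integrable V μ := by
  have h1 : ∫⁻ x, ENNReal.ofReal ((V x / 2 + C) / 2) ∂μ ≠ ⊤ := by
    have : ∫⁻ x, ENNReal.ofReal ((V x / 2 + C) / 2) ∂μ = ∫⁻ p, ENNReal.ofReal ((V p.1 / 2 + C) / 2) ∂(μ.prod μ) := by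
      have := lintegral_prod_mul (μ := μ) (ν := μ) (f := fun x => ENNReal.ofReal ((V x / 2 + C) / 2)) (g := fun _ => 1) (by fun_prop) (by fun_prop)
      simpa using this.symm
    rw [this]
    refine ((lintegral_mono fun p => ?_).trans_lt (lt_top_iff_ne_top.2 h)).ne
    unfold Fk
    split_ifs with hp
    · exact le_top
    · exact ENNReal.ofReal_le_ofReal (kE_zero_lower hd hC hp)
  have h2 : Integrable (fun x => (V x / 2 + C) / 2) μ := by
    refine (lintegral_ofReal_ne_top_iff_integrable (by fun_prop) (ae_of_all _ fun x => ?_)).1 h1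
    have := hC x
    have := norm_nonneg x
    simp only [Pi.zero_apply]
    linarith
  have h3 := ((h2.const_mul 4).sub (integrable_const (2 * C)))
  refine h3.congr (ae_of_all _ fun x => ?_)
  simp only [Pi.sub_apply]
  ring

lemma mix_prod {E : Type*} [MeasurableSpace E] (μ ν : Measure E) [IsProbabilityMeasure μ] [IsProbabilityMeasure ν]
    (t s : ℝ) (f : E × E → ℝ≥0∞) :
    ∫⁻ p, f p ∂((ENNReal.ofReal t • μ + ENNReal.ofReal s • ν).prod (ENNReal.ofReal t • μ + ENNReal.ofReal s • ν))
    = ENNReal.ofReal t * (ENNReal.ofReal t * ∫⁻ p, f p ∂(μ.prod μ)) + ENNReal.ofReal t * (ENNReal.ofReal s * ∫⁻ p, f p ∂(μ.prod ν))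
      + (ENNReal.ofReal s * (ENNReal.ofReal t * ∫⁻ p, f p ∂(ν.prod μ)) + ENNReal.ofReal s * (ENNReal.ofReal s * ∫⁻ p, f p ∂(ν.prod ν))) := by
  have R : ∀ (a b : Measure E) [IsProbabilityMeasure a] [IsProbabilityMeasure b] (r : ℝ), a.prod (ENNReal.ofReal r • b) = ENNReal.ofReal r • a.prod b := by
    intro a b _ _ r
    exact Measure.prod_smul_right _
  rw [Measure.add_prod, Measure.prod_smul_left, Measure.prod_smul_left, Measure.prod_add, Measure.prod_add]
  simp only [R, lintegral_add_measure, lintegral_smul_measure, smul_eq_mul]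
  ring

/-- under the growth condition, the domain of the electrostatic energy is
convex, the energy is convex on its domain, and every probability measure of finite
energy has a finite `p`-th moment. -/
theorem stmt5 (d : ℕ) (hd : 2 ≤ d) (V : Euc d → ℝ) (hVlsc : LowerSemicontinuous V)
    (a q R : ℝ) (ha : 0 < a) (hq : 1 < q) (hgrowth : GrowthCond d V a q R)
    (p : ℝ) (hp1 : 1 < p) (hpq : p < q) :
    -- the domain `D_E` is convex
    (∀ μ ν : Measure (Euc d),
      IsProbabilityMeasure μ → energy d V μ ≠ ⊤ →
      IsProbabilityMeasure ν → energy d V ν ≠ ⊤ →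
      ∀ t : ℝ, 0 ≤ t → t ≤ 1 →
        IsProbabilityMeasure (ENNReal.ofReal t • μ + ENNReal.ofReal (1 - t) • ν) ∧
        energy d V (ENNReal.ofReal t • μ + ENNReal.ofReal (1 - t) • ν) ≠ ⊤) ∧
    -- `E` is convex on `D_E`
    (∀ μ ν : Measure (Euc d),
      IsProbabilityMeasure μ → energy d V μ ≠ ⊤ →
      IsProbabilityMeasure ν → energy d V ν ≠ ⊤ →
      ∀ t : ℝ, 0 ≤ t → t ≤ 1 →
        energy d V (ENNReal.ofReal t • μ + ENNReal.ofReal (1 - t) • ν)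
          ≤ (t : EReal) * energy d V μ + ((1 - t : ℝ) : EReal) * energy d V ν) ∧
    -- `D_E ⊆ P_p(ℝ^d)`
    (∀ μ : Measure (Euc d), IsProbabilityMeasure μ → energy d V μ ≠ ⊤ →
      FiniteMoment d p μ) := by
  obtain ⟨C, hC0, hC'⟩ := growth_aux ha hp1 hpq R
  have hCp : ∀ x : Euc d, 2 * (‖x‖ ^ p + ‖x‖) ≤ V x / 2 + C := fun x => by
    have := hC' ‖x‖ (norm_nonneg x)
    have := hgrowth x
    linarith
  have hC : ∀ x : Euc d, 2 * ‖x‖ ≤ V x / 2 + C := fun x => by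
    have := hCp x
    have : 0 ≤ ‖x‖ ^ p := by positivity
    linarith
  have hV : Measurable V := hVlsc.measurable
  have main : ∀ μ ν : Measure (Euc d),
      IsProbabilityMeasure μ → energy d V μ ≠ ⊤ →
      IsProbabilityMeasure ν → energy d V ν ≠ ⊤ →
      ∀ t : ℝ, 0 ≤ t → t ≤ 1 →
        IsProbabilityMeasure (ENNReal.ofReal t • μ + ENNReal.ofReal (1 - t) • ν) ∧
        energy d V (ENNReal.ofReal t • μ + ENNReal.ofReal (1 - t) • ν) ≠ ⊤ ∧
        energy d V (ENNReal.ofReal t • μ + ENNReal.ofReal (1 - t) • ν)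
          ≤ (t : EReal) * energy d V μ + ((1 - t : ℝ) : EReal) * energy d V ν := by
    intro μ ν hμ eμ hν eν t ht0 ht1
    have hs : 0 ≤ 1 - t := by linarith
    have hprob : IsProbabilityMeasure (ENNReal.ofReal t • μ + ENNReal.ofReal (1 - t) • ν) := by
      constructor
      simp only [Measure.coe_add, Measure.coe_smul, Pi.add_apply, Pi.smul_apply, measure_univ, smul_eq_mul, mul_one]
      rw [← ENNReal.ofReal_add ht0 hs]
      simp
    have f1 := (energy_rel hd hV hC0 hC μ).1 eμ
    have f2 := (energy_rel hd hV hC0 hC ν).1 eν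
    have pd := Fk_pd hd hV hC (V_integrable hd hV hC μ f1) (V_integrable hd hV hC ν f2)
    unfold PDk at pd
    have mix := mix_prod μ ν t (1 - t) (Fk d V C)
    have r1 := (energy_rel hd hV hC0 hC μ).2 f1
    have r2 := (energy_rel hd hV hC0 hC ν).2 f2
    have r3 := (energy_rel hd hV hC0 hC (ENNReal.ofReal t • μ + ENNReal.ofReal (1 - t) • ν)).2
    have hcross := ne_top_of_le_ne_top (ENNReal.add_ne_top.2 ⟨f1, f2⟩) pd
    obtain ⟨f3, f4⟩ := ENNReal.add_ne_top.1 hcross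
    rw [mix] at r3
    set a1 := ∫⁻ p, Fk d V C p ∂(μ.prod μ)
    set a2 := ∫⁻ p, Fk d V C p ∂(ν.prod ν)
    set a3 := ∫⁻ p, Fk d V C p ∂(μ.prod ν)
    set a4 := ∫⁻ p, Fk d V C p ∂(ν.prod μ)
    clear_value a1 a2 a3 a4
    lift a1 to ℝ≥0 using f1
    lift a2 to ℝ≥0 using f2
    lift a3 to ℝ≥0 using f3
    lift a4 to ℝ≥0 using f4
    have r3 := r3 (by simp [ENNReal.mul_eq_top])
    refine ⟨hprob, by rw [r3]; exact EReal.coe_ne_top _, ?_⟩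
    rw [r3, r1, r2, ← EReal.coe_mul, ← EReal.coe_mul, ← EReal.coe_add, EReal.coe_le_coe_iff]
    have pd' : (a3 : ℝ) + a4 ≤ a1 + a2 := by exact_mod_cast pd
    rw [ENNReal.toReal_add (by simp [ENNReal.mul_eq_top]) (by simp [ENNReal.mul_eq_top]),
      ENNReal.toReal_add (by simp [ENNReal.mul_eq_top]) (by simp [ENNReal.mul_eq_top]),
      ENNReal.toReal_add (by simp [ENNReal.mul_eq_top]) (by simp [ENNReal.mul_eq_top])]
    simp only [ENNReal.toReal_mul, ENNReal.toReal_ofReal ht0, ENNReal.toReal_ofReal hs, ENNReal.coe_toReal]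
    nlinarith [mul_le_mul_of_nonneg_left pd' (mul_nonneg ht0 hs)]
  refine ⟨fun μ ν h1 h2 h3 h4 t h5 h6 => ⟨(main μ ν h1 h2 h3 h4 t h5 h6).1, (main μ ν h1 h2 h3 h4 t h5 h6).2.1⟩,
    fun μ ν h1 h2 h3 h4 t h5 h6 => (main μ ν h1 h2 h3 h4 t h5 h6).2.2, fun μ hμ eμ => ?_⟩
  have hi := V_integrable hd hV hC μ ((energy_rel hd hV hC0 hC μ).1 eμ)
  have hi2 : Integrable (fun x => V x / 2 + C) μ := (hi.div_const 2).add (integrable_const C)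
  unfold FiniteMoment
  refine ((lintegral_mono fun x => ENNReal.ofReal_le_ofReal ?_).trans_lt hi2.lintegral_lt_top).ne
  have := hCp x
  have : 0 ≤ ‖x‖ ^ p := by positivity
  have := norm_nonneg x
  linarith

end
end
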